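/- For every constant d with 0 < d ≤ 3/13 and every ε > 0 there is a constant C such that every connected undirected unweighted graph G on n vertices admits a subgraph H satisfying δ_H(u,v) ≤ δ_G(u,v) + C·n^d for all vertices u, v, with at most C·n^{4/3 − 7d/9 + ε} edges. -/

import Mathlib

open Finset in
theorem tri_count {V E L : Type*} [DecidableEq V] [DecidableEq E] [DecidableEq L]
    (A : Finset V) (τ : V → ℤ) (Ls : Finset L) (Φ : Finset (V × E)) (ln : V × E → L) (δ : ℕ)
    (hA : ∀ φ ∈ Φ, φ.1 ∈ A) (hL : ∀ φ ∈ Φ, ln φ ∈ Ls)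
    (h1 : ∀ φ ∈ Φ, ∀ ψ ∈ Φ, ln φ = ln ψ → τ φ.1 = τ ψ.1 → φ = ψ)
    (h2 : ∀ φ₀ ∈ Φ, ∀ φ₁ ∈ Φ, ∀ ψ₀ ∈ Φ, ∀ ψ₁ ∈ Φ, φ₀.1 = φ₁.1 → ln φ₀ = ln ψ₀ → ln φ₁ = ln ψ₁ →
      τ φ₀.1 < τ ψ₀.1 → τ φ₁.1 < τ ψ₁.1 →
      (ψ₀.1 = ψ₁.1 ∨ ∃ χ₀ ∈ Φ, ∃ χ₁ ∈ Φ, χ₀.1 = ψ₀.1 ∧ χ₁.1 = ψ₁.1 ∧ ln χ₀ = ln χ₁ ∧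
        τ χ₀.1 ≤ τ χ₁.1) → φ₀ = φ₁)
    (h3 : ∀ y ∈ A, δ + 1 ≤ #{φ ∈ Φ | φ.1 = y}) :
    δ * #Φ ^ 2 ≤ 2 * #Ls ^ 2 * #A + δ * #Ls * #Φ := by
  classical
  set Q : Finset ((V × E) × (V × E)) :=
    {p ∈ Φ ×ˢ Φ | ln p.1 = ln p.2 ∧ τ p.1.1 < τ p.2.1} with hQ
  have hcs : #Φ ^ 2 ≤ #Ls * (2 * #Q + #Φ) := by
    have e1 : #Φ = ∑ l ∈ Ls, #{φ ∈ Φ | ln φ = l} := card_eq_sum_card_fiberwise hL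
    have e2 : ∑ l ∈ Ls, #{φ ∈ Φ | ln φ = l} ^ 2 ≤ 2 * #Q + #Φ := by
      have : ∑ l ∈ Ls, #{φ ∈ Φ | ln φ = l} ^ 2 = #{p ∈ Φ ×ˢ Φ | ln p.1 = ln p.2} := by
        rw [card_eq_sum_card_fiberwise (f := fun p => ln p.1) (t := Ls)]
        · refine sum_congr rfl fun l _ => ?_
          rw [sq, ← card_product]
          congr 1
          ext ⟨a, b⟩
          simp only [mem_product, mem_filter]
          constructor
          · rintro ⟨⟨h, h'⟩, k2, k3⟩
            exact ⟨⟨⟨h, k2⟩, by rw [h', k3]⟩, h'⟩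
          · rintro ⟨⟨⟨h, k2⟩, h3⟩, h'⟩
            exact ⟨⟨h, h'⟩, k2, by rw [← h3, h']⟩
        · intro p hp
          simp only [coe_filter, mem_product, Set.mem_setOf_eq] at hp
          exact hL _ hp.1.1
      rw [this]
      have hsub : ({p ∈ Φ ×ˢ Φ | ln p.1 = ln p.2} : Finset _) ⊆
          (Q ∪ Q.image Prod.swap) ∪ Φ.image (fun φ => (φ, φ)) := by
        rintro ⟨a, b⟩ hp
        simp only [mem_filter, mem_product] at hp
        obtain ⟨⟨ha, hb⟩, hl⟩ := hp
        simp only [mem_union, mem_image]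
        rcases lt_trichotomy (τ a.1) (τ b.1) with h | h | h
        · left; left; simp [hQ, ha, hb, hl, h]
        · right; exact ⟨a, ha, by rw [h1 a ha b hb hl h]⟩
        · left; right; exact ⟨(b, a), by simp [hQ, ha, hb, hl, h], rfl⟩
      refine (card_le_card hsub).trans ((card_union_le _ _).trans ?_)
      have := card_union_le Q (Q.image Prod.swap)
      have := card_image_le (s := Q) (f := Prod.swap)
      have := card_image_le (s := Φ) (f := fun φ => (φ, φ))
      omega
    have e3 := sq_sum_le_card_mul_sum_sq (s := Ls) (f := fun l => #{φ ∈ Φ | ln φ = l})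
    rw [← e1] at e3
    exact e3.trans (Nat.mul_le_mul_left _ e2)
  set T : Finset ((V × E) × ((V × E) × (V × E))) :=
    {t ∈ Φ ×ˢ Q | t.1.1 = t.2.1.1 ∧ t.1 ≠ t.2.1} with hT
  have hTlow : δ * #Q ≤ #T := by
    rw [card_eq_sum_card_fiberwise (f := fun t => t.2) (t := Q) (s := T)]
    · rw [mul_comm, ← smul_eq_mul]
      refine card_nsmul_le_sum _ _ _ fun p hp => ?_
      have hpΦ : p.1 ∈ Φ := by
        simp only [hQ, mem_filter, mem_product] at hp; exact hp.1.1
      have := h3 p.1.1 (hA _ hpΦ)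
      have h4 : #(({φ ∈ Φ | φ.1 = p.1.1}).erase p.1) ≤ #{t ∈ T | t.2 = p} := by
        refine card_le_card_of_injOn (fun φ => (φ, p)) ?_ ?_
        · intro φ hφ
          simp only [coe_erase, coe_filter, Set.mem_diff, Set.mem_setOf_eq,
            Set.mem_singleton_iff] at hφ
          simp only [coe_filter, Set.mem_setOf_eq, hT, mem_filter, mem_product]
          exact ⟨⟨⟨hφ.1.1, hp⟩, hφ.1.2, hφ.2⟩, trivial⟩
        · intro a _ b _ h
          exact (Prod.mk.inj h).1
      rw [card_erase_of_mem (by simp [hpΦ])] at h4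
      omega
    · intro t ht
      simp only [hT, coe_filter, mem_product, Set.mem_setOf_eq] at ht
      exact ht.1.2
  have hTup : #T ≤ #Ls * #A := by
    rw [← card_product]
    refine card_le_card_of_injOn (fun t => (ln t.1, t.2.2.1)) ?_ ?_
    · intro t ht
      simp only [hT, hQ, coe_filter, mem_product, mem_filter, Set.mem_setOf_eq] at ht
      simp only [coe_product, Set.mem_prod, mem_coe]
      exact ⟨hL _ ht.1.1, hA _ ht.1.2.1.2⟩
    · rintro ⟨φ₀, φ₁, ψ⟩ ht ⟨φ₀', φ₁', ψ'⟩ ht' heq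
      simp only [hT, hQ, coe_filter, mem_product, mem_filter, Set.mem_setOf_eq] at ht ht'
      obtain ⟨⟨m0, ⟨m1, m2⟩, l, t⟩, e, ne⟩ := ht
      obtain ⟨⟨m0', ⟨m1', m2'⟩, l', t'⟩, e', ne'⟩ := ht'
      simp only [Prod.mk.injEq] at heq
      obtain ⟨hl, hz⟩ := heq
      rcases lt_trichotomy (τ φ₀.1) (τ φ₀'.1) with h | h | h
      · exact absurd (h2 φ₀ m0 φ₁ m1 φ₀' m0' ψ m2 e hl l h t
          (Or.inr ⟨φ₁', m1', ψ', m2', e'.symm, hz.symm, l', t'.le⟩)) ne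
      · have a0 := h1 _ m0 _ m0' hl h
        subst a0
        have a1 := h2 φ₁ m1 φ₁' m1' ψ m2 ψ' m2' (e.symm.trans e') l l' t t' (Or.inl hz)
        subst a1
        have a2 := h1 _ m2 _ m2' (l.symm.trans l') (by rw [hz])
        rw [a2]
      · exact absurd (h2 φ₀' m0' φ₁' m1' φ₀ m0 ψ' m2' e' hl.symm l' h t'
          (Or.inr ⟨φ₁, m1, ψ, m2, e.symm, hz, l, t.le⟩)) ne'
  have h5 : δ * #Q ≤ #Ls * #A := hTlow.trans hTup
  calc δ * #Φ ^ 2 ≤ δ * (#Ls * (2 * #Q + #Φ)) := Nat.mul_le_mul_left _ hcs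
    _ = 2 * #Ls * (δ * #Q) + δ * #Ls * #Φ := by ring
    _ ≤ 2 * #Ls * (#Ls * #A) + δ * #Ls * #Φ := by gcongr
    _ = _ := by ring


/-- `y` is the only vertex at its level on geodesics from `s` to `t`. -/
def MCut {V : Type*} (d : V → V → ℕ) (s t y : V) : Prop :=
  d s y + d y t = d s t ∧ ∀ z, d s z = d s y → d z t = d y t → z = y

/-- The ordered edge `f` is critical for the pair `q`. -/
def Crit {V : Type*} (d : V → V → ℕ) (q f : V × V) : Prop :=
  MCut d q.1 q.2 f.1 ∧ MCut d q.1 q.2 f.2 ∧ d q.1 f.1 + 1 = d q.1 f.2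

/-- A geodesic integer metric. -/
structure GMet {V : Type*} (d : V → V → ℕ) : Prop where
  self : ∀ x, d x x = 0
  symm : ∀ x y, d x y = d y x
  tri : ∀ x y z, d x z ≤ d x y + d y z
  eq : ∀ x y, d x y = 0 → x = y
  mid : ∀ x y i, i ≤ d x y → ∃ z, d x z = i ∧ d z y + i = d x y

theorem MCut.eq_of {V : Type*} {d : V → V → ℕ} {s t y w : V} (hy : MCut d s t y)
    (hw : MCut d s t w) (h : d s y = d s w) : y = w := by
  refine hw.2 y h ?_
  have := hy.1; have := hw.1; omega

theorem MCut.dist_of_le {V : Type*} {d : V → V → ℕ} (hd : GMet d) {s t y w : V}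
    (hy : MCut d s t y) (hw : MCut d s t w) (h : d s y ≤ d s w) : d s y + d y w = d s w := by
  obtain ⟨z, hz1, hz2⟩ := hd.mid s w (d s y) h
  have h1 := hd.tri z w t
  have h2 := hd.tri s z t
  have h3 := hy.1
  have h4 := hw.1
  have : z = y := hy.2 z hz1 (by omega)
  subst this
  omega

theorem MCut.dist {V : Type*} {d : V → V → ℕ} (hd : GMet d) {s t y w : V}
    (hy : MCut d s t y) (hw : MCut d s t w) : (d y w : ℤ) = |(d s y : ℤ) - d s w| := by
  rcases le_total (d s y) (d s w) with h | h
  · have := hy.dist_of_le hd hw h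
    rw [abs_of_nonpos (by omega)]; omega
  · have := hw.dist_of_le hd hy h
    rw [hd.symm y w, abs_of_nonneg (by omega)]; omega

/-- direction of the edge `f` seen from its endpoint `y`. -/
def fdir {V : Type*} [DecidableEq V] (y : V) (f : V × V) : ℤ := if y = f.1 then 1 else -1

def foth {V : Type*} [DecidableEq V] (y : V) (f : V × V) : V := if y = f.1 then f.2 else f.1

theorem flag_facts {V : Type*} [DecidableEq V] {d : V → V → ℕ} {q f : V × V} {y : V}
    (hc : Crit d q f) (hy : y = f.1 ∨ y = f.2) :
    MCut d q.1 q.2 y ∧ MCut d q.1 q.2 (foth y f) ∧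
      (d q.1 (foth y f) : ℤ) = d q.1 y + fdir y f ∧ (fdir y f = 1 ∨ fdir y f = -1) ∧
      (fdir y f = 1 → f = (y, foth y f)) ∧ (fdir y f = -1 → f = (foth y f, y)) := by
  obtain ⟨h1, h2, h3⟩ := hc
  obtain ⟨a, b⟩ := f
  simp only at *
  unfold fdir foth
  by_cases h : y = a
  · subst h
    simp [h1, h2]; omega
  · have h' : y = b := by tauto
    subst h'
    simp [h, h1, h2]; omega

open Finset in
theorem core_eps {V : Type*} [DecidableEq V] {d : V → V → ℕ} (hd : GMet d)
    (P F : Finset (V × V)) (q : V × V → V × V) (hq : ∀ f ∈ F, q f ∈ P ∧ Crit d (q f) f)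
    (hF : ∀ a b, (a, b) ∈ F → (b, a) ∉ F)
    (A : Finset V) (i : V → ℤ) (base : V × V → ℤ → ℤ) (Φ : Finset (V × (V × V)))
    (hΦ : ∀ φ ∈ Φ, φ.1 ∈ A ∧ φ.2 ∈ F ∧ (φ.1 = φ.2.1 ∨ φ.1 = φ.2.2) ∧
      |(d (q φ.2).1 φ.1 : ℤ) - fdir φ.1 φ.2 * i φ.1 - base (q φ.2) (fdir φ.1 φ.2)| ≤ 2)
    (δ : ℕ) (h3 : ∀ y ∈ A, δ + 1 ≤ #{φ ∈ Φ | φ.1 = y}) :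
    δ * #Φ ^ 2 ≤ 2 * (10 * #P) ^ 2 * #A + δ * (10 * #P) * #Φ := by
  have hcard : #(P ×ˢ (({1, -1} : Finset ℤ) ×ˢ (Icc (-2) 2 : Finset ℤ))) = 10 * #P := by
    rw [card_product, card_product]; simp; ring
  rw [← hcard]
  set ln : V × (V × V) → (V × V) × (ℤ × ℤ) := fun φ =>
    (q φ.2, fdir φ.1 φ.2,
      (d (q φ.2).1 φ.1 : ℤ) - fdir φ.1 φ.2 * i φ.1 - base (q φ.2) (fdir φ.1 φ.2)) with hln
  have key : ∀ φ ∈ Φ, ∀ ψ ∈ Φ, ln φ = ln ψ → q φ.2 = q ψ.2 ∧ fdir φ.1 φ.2 = fdir ψ.1 ψ.2 ∧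
      (d (q φ.2).1 φ.1 : ℤ) - d (q φ.2).1 ψ.1 = fdir φ.1 φ.2 * (i φ.1 - i ψ.1) := by
    intro φ hφ ψ hψ h
    simp only [hln, Prod.mk.injEq] at h
    obtain ⟨h1, h2, h3⟩ := h
    refine ⟨h1, h2, ?_⟩
    rw [← h1, ← h2] at h3
    linarith
  have ff : ∀ φ ∈ Φ, _ := fun φ hφ => flag_facts (hq _ (hΦ φ hφ).2.1).2 (hΦ φ hφ).2.2.1
  refine tri_count A i _ Φ ln δ (fun φ hφ => (hΦ φ hφ).1) ?_ ?_ ?_ h3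
  · intro φ hφ
    obtain ⟨a, b, c, e⟩ := hΦ φ hφ
    simp only [hln, mem_product, mem_insert, mem_singleton, mem_Icc]
    exact ⟨(hq _ b).1, (ff φ hφ).2.2.2.1, abs_le.1 e⟩
  · intro φ hφ ψ hψ hl ht
    obtain ⟨k1, k2, k3⟩ := key φ hφ ψ hψ hl
    obtain ⟨a1, a2, a3, a4, a5, a6⟩ := ff φ hφ
    obtain ⟨b1, b2, b3, b4, b5, b6⟩ := ff ψ hψ
    rw [ht, sub_self, mul_zero] at k3
    rw [← k1] at b1 b2 b3
    have e1 : φ.1 = ψ.1 := a1.eq_of b1 (by omega)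
    have e2 : foth φ.1 φ.2 = foth ψ.1 ψ.2 := a2.eq_of b2 (by omega)
    rcases a4 with h | h
    · exact Prod.ext e1 (by rw [a5 h, b5 (k2 ▸ h), e2, e1])
    · exact Prod.ext e1 (by rw [a6 h, b6 (k2 ▸ h), e2, e1])
  · intro φ₀ m0 φ₁ m1 ψ₀ n0 ψ₁ n1 hy l0 l1 t0 t1 hor
    obtain ⟨k1, k2, k3⟩ := key φ₀ m0 ψ₀ n0 l0
    obtain ⟨k1', k2', k3'⟩ := key φ₁ m1 ψ₁ n1 l1
    obtain ⟨a1, a2, a3, a4, a5, a6⟩ := ff φ₀ m0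
    obtain ⟨a1', a2', a3', a4', a5', a6'⟩ := ff φ₁ m1
    have b1 := (ff ψ₀ n0).1
    have b1' := (ff ψ₁ n1).1
    rw [← k1] at b1
    rw [← k1'] at b1'
    have d1 : (d (foth φ₀.1 φ₀.2) ψ₀.1 : ℤ) ≤ i ψ₀.1 - i φ₀.1 - 1 := by
      rw [a2.dist hd b1, abs_le]
      rcases a4 with h | h <;> rw [h] at k3 a3 <;> constructor <;> omega
    have d2 : (d ψ₀.1 ψ₁.1 : ℤ) ≤ i ψ₁.1 - i ψ₀.1 := by
      rcases hor with h | ⟨χ₀, c0, χ₁, c1, e0, e1, hl, ht⟩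
      · rw [h, hd.self]; simp
      · obtain ⟨g1, g2, g3⟩ := key χ₀ c0 χ₁ c1 hl
        have f0 := ff χ₀ c0
        have f1 := (ff χ₁ c1).1
        rw [← g1] at f1
        rw [← e0, ← e1, f0.1.dist hd f1, abs_le]
        rcases f0.2.2.2.1 with h | h <;> rw [h] at g3 <;> constructor <;> omega
    have d3 : (d φ₀.1 (foth φ₀.1 φ₀.2) : ℤ) = 1 := by
      rw [a1.dist hd a2]
      rcases a4 with h | h <;> rw [h] at a3 <;> rw [a3] <;> simp
    have t1' := hd.tri (foth φ₀.1 φ₀.2) ψ₀.1 ψ₁.1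
    have p1 := a1'.1
    have p2 := b1'.1
    have p3 := a2'.1
    rw [hy] at d3 d1
    have e2 : foth φ₀.1 φ₀.2 = foth φ₁.1 φ₁.2 := by
      rw [← hy] at d3 d1
      set w := foth φ₀.1 φ₀.2 with hw
      rw [hy] at d3 d1
      have u1 := hd.tri (q φ₁.2).1 w (q φ₁.2).2
      have u2 := hd.tri (q φ₁.2).1 φ₁.1 w
      have u3 := hd.tri w φ₁.1 (q φ₁.2).2
      have u4 := hd.symm w φ₁.1
      have u5 := hd.tri w ψ₁.1 (q φ₁.2).2
      have u6 := hd.tri (q φ₁.2).1 ψ₁.1 w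
      have u7 := hd.symm w ψ₁.1
      rcases a4' with h | h
      · rw [h] at k3' a3'
        exact a2'.2 _ (by omega) (by omega)
      · rw [h] at k3' a3'
        exact a2'.2 _ (by omega) (by omega)
    have r0 := (hΦ _ m0).2.1
    have r1 := (hΦ _ m1).2.1
    refine Prod.ext hy ?_
    rcases a4 with h | h <;> rcases a4' with h' | h'
    · rw [a5 h, a5' h', hy, ← e2, hy]
    · rw [a5 h] at r0
      rw [a6' h', ← e2, ← hy] at r1
      exact absurd r1 (hF _ _ r0)
    · rw [a6 h] at r0
      rw [a5' h', ← e2, ← hy] at r1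
      exact absurd r1 (hF _ _ r0)
    · rw [a6 h, a6' h', hy, ← e2, hy]

open Finset in
theorem core_arith (δ L Φ A : ℕ) (h : δ * Φ ^ 2 ≤ 2 * L ^ 2 * A + δ * L * Φ) (hΦ : (δ + 1) * A ≤ Φ) :
    (δ + 1) * A ≤ 2 * L ∨ δ * (δ + 1) ^ 2 * A ≤ 4 * L ^ 2 := by
  by_cases h1 : Φ ≤ 2 * L
  · left; omega
  · right
    push Not at h1
    have h2 : δ * Φ ^ 2 ≤ 4 * L ^ 2 * A := by
      have : 2 * (δ * L * Φ) ≤ δ * Φ ^ 2 := by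
        calc 2 * (δ * L * Φ) = (δ * Φ) * (2 * L) := by ring
          _ ≤ (δ * Φ) * Φ := by gcongr
          _ = _ := by ring
      nlinarith
    rcases Nat.eq_zero_or_pos A with rfl | hA
    · simp
    · refine Nat.le_of_mul_le_mul_right ?_ hA
      calc δ * (δ + 1) ^ 2 * A * A = δ * ((δ + 1) * A) ^ 2 := by ring
        _ ≤ δ * Φ ^ 2 := by gcongr
        _ ≤ _ := h2

open Finset in
theorem core_A {V : Type*} [DecidableEq V] {d : V → V → ℕ} (hd : GMet d)
    (P F : Finset (V × V)) (q : V × V → V × V) (hq : ∀ f ∈ F, q f ∈ P ∧ Crit d (q f) f)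
    (hF : ∀ a b, (a, b) ∈ F → (b, a) ∉ F)
    (A : Finset V) (i : V → ℤ)
    (hi : ∀ y ∈ A, ∀ w ∈ A, abs ((d y w : ℤ) - |i y - i w|) ≤ 2) (δ : ℕ)
    (h3 : ∀ y ∈ A, 2 * (δ + 1) ≤ #{f ∈ F | y = f.1 ∨ y = f.2}) :
    (δ + 1) * #A ≤ 40 * #P ∨ δ * (δ + 1) ^ 2 * #A ≤ 800 * #P ^ 2 := by
  classical
  have hb : ∀ p : V × V, ∃ y0 : V, (∃ y ∈ A, ∃ f ∈ F, q f = p ∧ (y = f.1 ∨ y = f.2)) →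
      y0 ∈ A ∧ ∃ f ∈ F, q f = p ∧ (y0 = f.1 ∨ y0 = f.2) := by
    intro p
    by_cases h : ∃ y ∈ A, ∃ f ∈ F, q f = p ∧ (y = f.1 ∨ y = f.2)
    · obtain ⟨y, hy⟩ := h; exact ⟨y, fun _ => hy⟩
    · exact ⟨p.1, fun h' => absurd h' h⟩
  choose y0 hy0 using hb
  set ok : ℤ → V → V × V → Prop := fun ε y f =>
    |(d (q f).1 y : ℤ) - fdir y f * (ε * i y) -
      ((d (q f).1 (y0 (q f)) : ℤ) - fdir y f * (ε * i (y0 (q f))))| ≤ 2 with hok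
  have hokor : ∀ y ∈ A, ∀ f ∈ F, (y = f.1 ∨ y = f.2) → ok 1 y f ∨ ok (-1) y f := by
    intro y hy f hf hyf
    obtain ⟨hA0, f0, hf0, hqf, hyf0⟩ := hy0 (q f) ⟨y, hy, f, hf, rfl, hyf⟩
    have c1 := flag_facts (hq f hf).2 hyf
    have c2 := (flag_facts (hq f0 hf0).2 hyf0).1
    rw [hqf] at c2
    have e := c1.1.dist hd c2
    have e2 := hi y hy _ hA0
    rw [e] at e2
    simp only [hok]
    generalize (d (q f).1 y : ℤ) = j at *
    generalize (d (q f).1 (y0 (q f)) : ℤ) = j0 at *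
    generalize i y = u at *
    generalize i (y0 (q f)) = u0 at *
    simp only [abs_le] at *
    rcases abs_cases (j - j0) with ⟨r1, r2⟩ | ⟨r1, r2⟩ <;>
      rcases abs_cases (u - u0) with ⟨r3, r4⟩ | ⟨r3, r4⟩ <;> rw [r1, r3] at e2 <;>
      rcases c1.2.2.2.1 with h | h <;> rw [h] <;> omega
  set fl : ℤ → V → Finset (V × V) := fun ε y => {f ∈ F | (y = f.1 ∨ y = f.2) ∧ ok ε y f} with hfl
  set Aε : ℤ → Finset V := fun ε => {y ∈ A | δ + 1 ≤ #(fl ε y)} with hAε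
  have hsplit : #A ≤ #(Aε 1) + #(Aε (-1)) := by
    refine (card_le_card ?_).trans (card_union_le _ _)
    intro y hy
    have h4 : #{f ∈ F | y = f.1 ∨ y = f.2} ≤ #(fl 1 y) + #(fl (-1) y) := by
      refine (card_le_card ?_).trans (card_union_le _ _)
      intro f hf
      simp only [mem_filter] at hf
      simp only [hfl, mem_union, mem_filter]
      rcases hokor y hy f hf.1 hf.2 with h | h
      · exact Or.inl ⟨hf.1, hf.2, h⟩
      · exact Or.inr ⟨hf.1, hf.2, h⟩
    have := h3 y hy
    simp only [hAε, mem_union, mem_filter, hy, true_and]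
    omega
  have main : ∀ ε : ℤ, (ε = 1 ∨ ε = -1) →
      ((δ + 1) * #(Aε ε) ≤ 2 * (10 * #P) ∨ δ * (δ + 1) ^ 2 * #(Aε ε) ≤ 4 * (10 * #P) ^ 2) := by
    intro ε hε
    set Φ : Finset (V × (V × V)) := {φ ∈ Aε ε ×ˢ F | φ.2 ∈ fl ε φ.1} with hΦ
    have hfib : ∀ y ∈ Aε ε, #{φ ∈ Φ | φ.1 = y} = #(fl ε y) := by
      intro y hy
      symm
      refine card_bij (fun f _ => (y, f)) ?_ ?_ ?_
      · intro f hf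
        have : f ∈ F := by simp only [hfl, mem_filter] at hf; exact hf.1
        simp only [hΦ, mem_filter, mem_product]
        exact ⟨⟨⟨hy, this⟩, hf⟩, trivial⟩
      · intro a _ b _ h; exact (Prod.mk.inj h).2
      · rintro ⟨a, f⟩ h
        simp only [hΦ, mem_filter, mem_product] at h
        obtain ⟨⟨⟨h1, h2⟩, h3⟩, rfl⟩ := h
        exact ⟨f, h3, rfl⟩
    have hge : ∀ y ∈ Aε ε, δ + 1 ≤ #{φ ∈ Φ | φ.1 = y} := by
      intro y hy
      rw [hfib y hy]
      simp only [hAε, mem_filter] at hy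
      exact hy.2
    refine core_arith δ (10 * #P) #Φ _ ?_ ?_
    · refine core_eps hd P F q hq hF (Aε ε) (fun y => ε * i y)
        (fun p η => (d p.1 (y0 p) : ℤ) - η * (ε * i (y0 p))) Φ ?_ δ hge
      rintro ⟨y, f⟩ hφ
      simp only [hΦ, hfl, mem_filter, mem_product] at hφ
      exact ⟨hφ.1.1, hφ.1.2, hφ.2.2.1, hφ.2.2.2⟩
    · rw [card_eq_sum_card_fiberwise (f := fun φ : V × (V × V) => φ.1) (t := Aε ε) (s := Φ)]
      · rw [mul_comm, ← smul_eq_mul]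
        exact card_nsmul_le_sum _ _ _ hge
      · intro φ hφ
        simp only [hΦ, coe_filter, mem_product, Set.mem_ofPred_eq] at hφ
        exact hφ.1.1
  rcases le_total #(Aε 1) #(Aε (-1)) with h | h
  · rcases main (-1) (Or.inr rfl) with h' | h'
    · left; nlinarith
    · right
      have : δ * (δ + 1) ^ 2 * #A ≤ δ * (δ + 1) ^ 2 * (2 * #(Aε (-1))) := by gcongr; omega
      nlinarith
  · rcases main 1 (Or.inl rfl) with h' | h'
    · left; nlinarith
    · right
      have : δ * (δ + 1) ^ 2 * #A ≤ δ * (δ + 1) ^ 2 * (2 * #(Aε 1)) := by gcongr; omega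
      nlinarith

open Finset in
theorem core_clean {V : Type*} [DecidableEq V] {d : V → V → ℕ} (hd : GMet d)
    (P F : Finset (V × V)) (q : V × V → V × V) (hq : ∀ f ∈ F, q f ∈ P ∧ Crit d (q f) f)
    (hF : ∀ a b, (a, b) ∈ F → (b, a) ∉ F) (hne : F.Nonempty) (δ μ : ℕ) (hδ : 1 ≤ δ) (hμ : 1 ≤ μ)
    (h3 : ∀ f ∈ F, ∀ y, (y = f.1 ∨ y = f.2) → 2 * (δ + 1) ≤ #{f ∈ F | y = f.1 ∨ y = f.2})
    (h4 : ∀ f ∈ F, 3 * μ ≤ #{g ∈ F | q g = q f}) :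
    (δ + 1) ^ 4 * μ ≤ 800 * #P ^ 2 := by
  classical
  obtain ⟨f₀, hf₀⟩ := hne
  set p := q f₀ with hp
  obtain ⟨ρ, hρ, hρc⟩ := exists_le_card_fiber_of_mul_le_card_of_maps_to
    (s := {g ∈ F | q g = p}) (t := range 3) (f := fun g => d p.1 g.1 % 3) (n := μ)
    (fun g _ => mem_range.2 (Nat.mod_lt _ (by norm_num))) (by simp) (by simpa using h4 f₀ hf₀)
  set Fp := ({g ∈ ({g ∈ F | q g = p} : Finset _) | d p.1 g.1 % 3 = ρ} : Finset (V × V)) with hFp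
  have hFpm : ∀ g ∈ Fp, g ∈ F ∧ q g = p ∧ d p.1 g.1 % 3 = ρ ∧ Crit d p g := by
    intro g hg
    simp only [hFp, mem_filter] at hg
    refine ⟨hg.1.1, hg.1.2, hg.2, ?_⟩
    have := (hq g hg.1.1).2
    rwa [hg.1.2] at this
  set U := Fp.image Prod.fst with hU
  have hUc : μ ≤ #U := by
    rw [hU, card_image_of_injOn]
    · exact hρc
    · intro a ha b hb h
      have c1 := (hFpm a ha).2.2.2
      have c2 := (hFpm b hb).2.2.2
      refine Prod.ext h (c1.2.1.eq_of c2.2.1 ?_)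
      have h1 := c1.2.2; have h2 := c2.2.2; rw [h] at h1; omega
  have hUm : ∀ v ∈ U, MCut d p.1 p.2 v ∧ d p.1 v % 3 = ρ ∧
      2 * (δ + 1) ≤ #{f ∈ F | v = f.1 ∨ v = f.2} := by
    intro v hv
    simp only [hU, mem_image] at hv
    obtain ⟨g, hg, rfl⟩ := hv
    have := hFpm g hg
    exact ⟨this.2.2.2.1, this.2.2.1, h3 g this.1 _ (Or.inl rfl)⟩
  set N : V → Finset V := fun v => ({f ∈ F | v = f.1 ∨ v = f.2} : Finset _).image (foth v) with hN
  have hfd : ∀ f ∈ F, ∀ v, (v = f.1 ∨ v = f.2) → d v (foth v f) = 1 := by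
    intro f hf v hv
    have c := flag_facts (hq f hf).2 hv
    have e := c.1.dist hd c.2.1
    rw [c.2.2.1] at e
    rcases c.2.2.2.1 with h | h <;> rw [h] at e <;> simp at e <;> omega
  have hNd : ∀ v, ∀ y ∈ N v, d v y = 1 ∧ 2 * (δ + 1) ≤ #{f ∈ F | y = f.1 ∨ y = f.2} := by
    intro v y hy
    simp only [hN, mem_image, mem_filter] at hy
    obtain ⟨f, ⟨hf, hv⟩, rfl⟩ := hy
    refine ⟨hfd f hf v hv, h3 f hf _ ?_⟩
    unfold foth
    split_ifs <;> simp
  have hNc : ∀ v, #(N v) = #{f ∈ F | v = f.1 ∨ v = f.2} := by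
    intro v
    refine card_image_of_injOn ?_
    rintro ⟨a, b⟩ ha ⟨a', b'⟩ hb h
    simp only [coe_filter, Set.mem_ofPred_eq] at ha hb
    simp only [foth] at h
    obtain ⟨ha1, ha2⟩ := ha
    obtain ⟨hb1, hb2⟩ := hb
    split_ifs at h with e1 e2 e2
    · subst e1 e2 h; rfl
    · have : v = b' := by tauto
      subst e1 this h
      exact absurd hb1 (hF _ _ ha1)
    · have : v = b := by tauto
      subst e2 this h
      exact absurd hb1 (hF _ _ ha1)
    · have h1 : v = b := by tauto
      have h2 : v = b' := by tauto
      rw [h, ← h1, ← h2]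
  have hdisj : (U : Set V).PairwiseDisjoint N := by
    intro v hv w hw hvw
    refine disjoint_left.2 fun y hy hy' => ?_
    obtain ⟨c1, m1, _⟩ := hUm v hv
    obtain ⟨c2, m2, _⟩ := hUm w hw
    have e := c1.dist hd c2
    have := (hNd v y hy).1
    have := (hNd w y hy').1
    have := hd.tri v y w
    have := hd.symm y w
    have hne : d p.1 v ≠ d p.1 w := fun h => hvw (c1.eq_of c2 h)
    rcases abs_cases ((d p.1 v : ℤ) - d p.1 w) with ⟨r1, r2⟩ | ⟨r1, r2⟩ <;> rw [r1] at e <;> omega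
  set A := U.biUnion N with hA
  have hAc : 2 * (δ + 1) * μ ≤ #A := by
    rw [hA, card_biUnion hdisj]
    calc 2 * (δ + 1) * μ ≤ 2 * (δ + 1) * #U := by gcongr
      _ = #U • (2 * (δ + 1)) := by rw [smul_eq_mul]; ring
      _ ≤ _ := card_nsmul_le_sum _ _ _ fun v hv => by rw [hNc]; exact (hUm v hv).2.2
  have hch : ∀ y, ∃ v, y ∈ A → v ∈ U ∧ y ∈ N v := by
    intro y
    by_cases h : y ∈ A
    · have h' := h
      simp only [hA, mem_biUnion] at h'
      obtain ⟨v, hv⟩ := h'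
      exact ⟨v, fun _ => hv⟩
    · exact ⟨y, fun h' => absurd h' h⟩
  choose vt hvt using hch
  have hcore := core_A hd P F q hq hF A (fun y => (d p.1 (vt y) : ℤ)) ?_ δ ?_
  · have e1 : (δ + 1) * (2 * (δ + 1) * μ) ≤ (δ + 1) * #A := by gcongr
    rcases hcore with h | h
    · have h5 : (δ + 1) ^ 2 * μ ≤ 20 * #P := by nlinarith
      have h6 : (δ + 1) ^ 2 ≤ 20 * #P := (Nat.le_mul_of_pos_right _ hμ).trans h5
      calc (δ + 1) ^ 4 * μ = (δ + 1) ^ 2 * ((δ + 1) ^ 2 * μ) := by ring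
        _ ≤ (20 * #P) * (20 * #P) := Nat.mul_le_mul h6 h5
        _ ≤ _ := by nlinarith
    · calc (δ + 1) ^ 4 * μ = (δ + 1) * (δ + 1) ^ 2 * ((δ + 1) * μ) := by ring
        _ ≤ (2 * δ) * (δ + 1) ^ 2 * ((δ + 1) * μ) := by gcongr; omega
        _ = δ * (δ + 1) ^ 2 * (2 * (δ + 1) * μ) := by ring
        _ ≤ δ * (δ + 1) ^ 2 * #A := by gcongr
        _ ≤ _ := h
  · intro y hy w hw
    obtain ⟨u1, n1⟩ := hvt y hy
    obtain ⟨u2, n2⟩ := hvt w hw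
    have e := (hUm _ u1).1.dist hd (hUm _ u2).1
    rw [← e]
    have a1 := (hNd _ _ n1).1
    have a2 := (hNd _ _ n2).1
    have t1 := hd.tri y (vt y) w
    have t2 := hd.tri (vt y) (vt w) w
    have t3 := hd.tri (vt y) y (vt w)
    have t4 := hd.tri y w (vt w)
    have s1 := hd.symm y (vt y)
    have s2 := hd.symm w (vt w)
    rw [abs_le]
    constructor <;> omega
  · intro y hy
    exact (hNd _ _ (hvt y hy).2).2


/-- there is a walk of length at most `k` from `u` to `v` in `H`. -/
def Wi {V : Type*} (H : SimpleGraph V) (u v : V) (k : ℕ) : Prop := ∃ p : H.Walk u v, p.length ≤ k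

namespace Wi
variable {V : Type*} {H H' : SimpleGraph V} {u v w : V} {k l : ℕ}

theorem mono (h : Wi H u v k) (hH : H ≤ H') : Wi H' u v k := by
  obtain ⟨p, hp⟩ := h
  exact ⟨p.mapLe hH, by simpa using hp⟩

theorem le (h : Wi H u v k) (hk : k ≤ l) : Wi H u v l := by
  obtain ⟨p, hp⟩ := h
  exact ⟨p, hp.trans hk⟩

theorem trans (h : Wi H u v k) (h' : Wi H v w l) : Wi H u w (k + l) := by
  obtain ⟨p, hp⟩ := h
  obtain ⟨p', hp'⟩ := h'
  exact ⟨p.append p', by rw [SimpleGraph.Walk.length_append]; omega⟩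

theorem symm (h : Wi H u v k) : Wi H v u k := by
  obtain ⟨p, hp⟩ := h
  exact ⟨p.reverse, by simpa using hp⟩

theorem refl (H : SimpleGraph V) (u : V) : Wi H u u 0 := ⟨SimpleGraph.Walk.nil, by simp⟩

theorem adj (h : H.Adj u v) : Wi H u v 1 := ⟨h.toWalk, by simp⟩

theorem reachable (h : Wi H u v k) : H.Reachable u v := h.choose.reachable

theorem dist_le (h : Wi H u v k) : H.dist u v ≤ k := by
  obtain ⟨p, hp⟩ := h
  exact (SimpleGraph.dist_le p).trans hp

theorem of_dist (hH : H.Connected) (u v : V) : Wi H u v (H.dist u v) := by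
  obtain ⟨p, hp⟩ := (hH u v).exists_walk_length_eq_dist
  exact ⟨p, hp.le⟩

theorem of_dist_le (hH : H.Connected) (h : H.dist u v ≤ k) : Wi H u v k := (of_dist hH u v).le h

theorem dist_le_of_le (h : Wi H u v k) (hH : H ≤ H') : H'.dist u v ≤ k := (h.mono hH).dist_le

end Wi

theorem gmet_dist {V : Type*} {H : SimpleGraph V} (hH : H.Connected) : GMet H.dist where
  self x := by simp
  symm x y := SimpleGraph.dist_comm
  tri x y z := hH.dist_triangle
  eq x y h := by rwa [hH.dist_eq_zero_iff] at h
  mid x y i hi := by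
    obtain ⟨p, hp⟩ := (hH x y).exists_walk_length_eq_dist
    refine ⟨p.getVert i, ?_⟩
    have h1 : H.dist x (p.getVert i) ≤ i := by
      refine (SimpleGraph.dist_le (p.take i)).trans ?_
      rw [SimpleGraph.Walk.take_length]; omega
    have h2 : H.dist (p.getVert i) y ≤ p.length - i := by
      refine (SimpleGraph.dist_le (p.drop i)).trans ?_
      rw [SimpleGraph.Walk.drop_length]
    have := hH.dist_triangle (u := x) (v := p.getVert i) (w := y)
    omega

theorem walk_avoid {V : Type*} {H : SimpleGraph V} (hH : H.Connected) (a b : V) :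
    ∀ {z w : V} (p : H.Walk z w), Wi (H.deleteEdges {s(a, b)}) z w p.length ∨
      H.dist z a + 1 + H.dist b w ≤ p.length ∨ H.dist z b + 1 + H.dist a w ≤ p.length := by
  intro z w p
  induction p with
  | nil => left; simpa using Wi.refl _ _
  | @cons x y w hxy p ih =>
    rw [SimpleGraph.Walk.length_cons]
    by_cases he : s(x, y) = s(a, b)
    · right
      have hp := SimpleGraph.dist_le p
      rcases Sym2.eq_iff.1 he with ⟨rfl, rfl⟩ | ⟨rfl, rfl⟩
      · left; simp; omega
      · right; simp; omega
    · have hd1 : H.dist x y ≤ 1 := by simpa using SimpleGraph.dist_le hxy.toWalk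
      have t1 := hH.dist_triangle (u := x) (v := y) (w := a)
      have t2 := hH.dist_triangle (u := x) (v := y) (w := b)
      rcases ih with ih | ih | ih
      · left
        have : (H.deleteEdges {s(a, b)}).Adj x y := by
          rw [SimpleGraph.deleteEdges_adj]; exact ⟨hxy, by simpa using he⟩
        exact ((Wi.adj this).trans ih).le (by omega)
      · right; left; omega
      · right; right; omega

theorem crit_of_delete {V : Type*} {H : SimpleGraph V} (hH : H.Connected) {a b s t : V}
    (hab : H.Adj a b)
    (hst : ¬ Wi (H.deleteEdges {s(a, b)}) s t (H.dist s t)) :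
    ∃ f : V × V, s(f.1, f.2) = s(a, b) ∧ Crit H.dist (s, t) f := by
  have key : ∀ z w, Wi (H.deleteEdges {s(a, b)}) z w (H.dist z w) ∨
      H.dist z a + 1 + H.dist b w ≤ H.dist z w ∨ H.dist z b + 1 + H.dist a w ≤ H.dist z w := by
    intro z w
    obtain ⟨p, hp⟩ := (hH z w).exists_walk_length_eq_dist
    rw [← hp]
    exact walk_avoid hH a b p
  have main : ∀ x y : V, (∀ z w, Wi (H.deleteEdges {s(a, b)}) z w (H.dist z w) ∨
      H.dist z x + 1 + H.dist y w ≤ H.dist z w ∨ H.dist z y + 1 + H.dist x w ≤ H.dist z w) →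
      H.dist x y ≤ 1 → H.dist s x + 1 + H.dist y t ≤ H.dist s t → Crit H.dist (s, t) (x, y) := by
    intro x y key hxy h
    have t1 := hH.dist_triangle (u := s) (v := x) (w := t)
    have t2 := hH.dist_triangle (u := x) (v := y) (w := t)
    have t3 := hH.dist_triangle (u := s) (v := x) (w := y)
    have t4 := hH.dist_triangle (u := s) (v := y) (w := t)
    have comb : ∀ z, H.dist s z + H.dist z t = H.dist s t →
        Wi (H.deleteEdges {s(a, b)}) s z (H.dist s z) →
        Wi (H.deleteEdges {s(a, b)}) z t (H.dist z t) → False := by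
      intro z hz h1 h2
      exact hst (by simpa [hz] using h1.trans h2)
    refine ⟨⟨by simp only; omega, fun z hz1 hz2 => ?_⟩, ⟨by simp only; omega, fun z hz1 hz2 => ?_⟩, by simp only; omega⟩
    · simp only at hz1 hz2 ⊢
      by_contra hne
      have hpos : H.dist z x ≠ 0 := fun h0 => hne (hH.dist_eq_zero_iff.1 h0)
      refine comb z (by omega) ?_ ?_
      · rcases key s z with h1 | h1 | h1
        · exact h1
        · omega
        · omega
      · rcases key z t with h1 | h1 | h1
        · exact h1
        · omega
        · omega
    · simp only at hz1 hz2 ⊢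
      by_contra hne
      have hpos : H.dist z y ≠ 0 := fun h0 => hne (hH.dist_eq_zero_iff.1 h0)
      have hc := SimpleGraph.dist_comm (G := H) (u := z) (v := y)
      refine comb z (by omega) ?_ ?_
      · rcases key s z with h1 | h1 | h1
        · exact h1
        · omega
        · omega
      · rcases key z t with h1 | h1 | h1
        · exact h1
        · omega
        · omega
  have hd1 : H.dist a b ≤ 1 := by simpa using SimpleGraph.dist_le hab.toWalk
  rcases key s t with h | h | h
  · exact absurd h hst
  · exact ⟨(a, b), rfl, main a b key hd1 h⟩
  · exact ⟨(b, a), Sym2.eq_swap, main b a (fun z w => by have := key z w; tauto)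
      (by rw [SimpleGraph.dist_comm]; exact hd1) h⟩

open Finset in
theorem clean_exists {ι K : Type*} [DecidableEq ι] [DecidableEq K] (F : Finset ι) (c : ι → Finset K)
    (w : K → ℕ) (h : ∑ k ∈ F.biUnion c, w k < #F) :
    ∃ F' ⊆ F, F'.Nonempty ∧ ∀ f ∈ F', ∀ k ∈ c f, w k ≤ #{g ∈ F' | k ∈ c g} := by
  classical
  obtain ⟨F', hF', hmax⟩ := exists_max_image F.powerset
    (fun F' => (#F' : ℤ) - ∑ k ∈ F'.biUnion c, (w k : ℤ)) ⟨F, by simp⟩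
  rw [mem_powerset] at hF'
  have h0 := hmax F (by simp)
  have h1 : (∑ k ∈ F.biUnion c, (w k : ℤ)) < #F := by exact_mod_cast h
  refine ⟨F', hF', ?_, ?_⟩
  · rw [nonempty_iff_ne_empty]
    rintro rfl
    simp at h0
    omega
  · intro f hf k hk
    by_contra hlt
    push Not at hlt
    have h2 := hmax ({g ∈ F' | k ∉ c g}) (by
      rw [mem_powerset]; exact (filter_subset _ _).trans hF')
    have h3 : #{g ∈ F' | k ∈ c g} + #{g ∈ F' | k ∉ c g} = #F' :=
      card_filter_add_card_filter_not _
    have hkm : k ∈ F'.biUnion c := mem_biUnion.2 ⟨f, hf, hk⟩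
    have h4 : ∑ k ∈ ({g ∈ F' | k ∉ c g} : Finset ι).biUnion c, (w k : ℤ) ≤
        ∑ k ∈ (F'.biUnion c).erase k, (w k : ℤ) := by
      refine sum_le_sum_of_subset_of_nonneg ?_ fun _ _ _ => by positivity
      intro x hx
      simp only [mem_biUnion, mem_filter] at hx
      obtain ⟨g, ⟨hg, hkg⟩, hx⟩ := hx
      rw [mem_erase]
      refine ⟨?_, mem_biUnion.2 ⟨g, hg, hx⟩⟩
      rintro rfl
      exact hkg hx
    have h5 := add_sum_erase (F'.biUnion c) (fun k => (w k : ℤ)) hkm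
    omega

open Finset in
theorem core_total {V : Type*} [Fintype V] [DecidableEq V] {d : V → V → ℕ} (hd : GMet d)
    (P F : Finset (V × V)) (q : V × V → V × V) (hq : ∀ f ∈ F, q f ∈ P ∧ Crit d (q f) f)
    (hF : ∀ a b, (a, b) ∈ F → (b, a) ∉ F) (δ μ : ℕ) (hδ : 1 ≤ δ) (hμ : 1 ≤ μ)
    (hc : 2 * (δ + 1) * Fintype.card V + 3 * μ * #P < #F) :
    (δ + 1) ^ 4 * μ ≤ 800 * #P ^ 2 := by
  classical
  set c : V × V → Finset (V ⊕ (V × V)) := fun f => {Sum.inl f.1, Sum.inl f.2, Sum.inr (q f)} with hcdef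
  set w : V ⊕ (V × V) → ℕ := Sum.elim (fun _ => 2 * (δ + 1)) (fun _ => 3 * μ) with hw
  have hsum : ∑ k ∈ F.biUnion c, w k < #F := by
    refine lt_of_le_of_lt ?_ hc
    calc ∑ k ∈ F.biUnion c, w k ≤ ∑ k ∈ (univ : Finset V).disjSum P, w k := by
          refine sum_le_sum_of_subset_of_nonneg ?_ fun _ _ _ => Nat.zero_le _
          intro x hx
          simp only [mem_biUnion, hcdef, mem_insert, mem_singleton] at hx
          obtain ⟨f, hf, rfl | rfl | rfl⟩ := hx
          · simp
          · simp
          · simpa using (hq f hf).1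
      _ = _ := by
          rw [sum_disjSum]; simp [hw]; ring
  obtain ⟨F', hsub, hne, hF'⟩ := clean_exists F c w hsum
  refine core_clean hd P F' q (fun f hf => hq f (hsub hf)) (fun a b h h' => hF a b (hsub h) (hsub h'))
    hne δ μ hδ hμ ?_ ?_
  · intro f hf y hy
    have h1 := hF' f hf (Sum.inl y) (by rcases hy with rfl | rfl <;> simp [hcdef])
    simp only [hw, Sum.elim_inl] at h1
    refine h1.trans (card_le_card ?_)
    intro g hg
    simpa [hcdef] using hg
  · intro f hf
    have h1 := hF' f hf (Sum.inr (q f)) (by simp [hcdef])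
    simp only [hw, Sum.elim_inr] at h1
    refine h1.trans (card_le_card ?_)
    intro g hg
    simp [hcdef] at hg
    simp [hg.1, hg.2.symm]

theorem preserver_graph {V : Type*} [Fintype V] {G : SimpleGraph V} (hG : G.Connected)
    (P : Finset (V × V)) : ∃ H ≤ G, (∀ p ∈ P, Wi H p.1 p.2 (G.dist p.1 p.2)) ∧ H.Connected ∧
      ∃ m : ℕ, H.edgeSet.ncard ≤ Fintype.card V + m ∧
      ∀ δ μ : ℕ, 1 ≤ δ → 1 ≤ μ → 2 * (δ + 1) * Fintype.card V + 3 * μ * P.card < m →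
        (δ + 1) ^ 4 * μ ≤ 800 * P.card ^ 2 := by
  classical
  obtain ⟨T, hTG, hT⟩ := hG.exists_isTree_le
  obtain ⟨H, hHG, hmin⟩ := exists_minimal_le_of_wellFoundedLT
    (fun H : SimpleGraph V => T ≤ H ∧ ∀ p ∈ P, Wi H p.1 p.2 (G.dist p.1 p.2)) G
    ⟨hTG, fun p _ => Wi.of_dist hG _ _⟩
  obtain ⟨⟨hTH, hHP⟩, hm⟩ := hmin
  have hHc : H.Connected := hT.1.mono hTH
  refine ⟨H, hHG, hHP, hHc, (H.edgeSet \ T.edgeSet).ncard, ?_, ?_⟩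
  · have h1 : H.edgeSet = T.edgeSet ∪ (H.edgeSet \ T.edgeSet) := by
      rw [Set.union_sdiff_cancel (SimpleGraph.edgeSet_subset_edgeSet.2 hTH)]
    have h2 : T.edgeSet.ncard ≤ Fintype.card V := by
      have := (SimpleGraph.isTree_iff_connected_and_card.1 hT).2
      rw [Nat.card_eq_fintype_card (α := V)] at this
      rw [← Nat.card_coe_set_eq]; omega
    calc H.edgeSet.ncard ≤ _ := by conv_lhs => rw [h1]
      _ ≤ _ := Set.ncard_union_le _ _
      _ ≤ _ := by omega
  · intro δ μ hδ hμ hlt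
    set Fs := H.edgeSet \ T.edgeSet with hFs
    have hcrit : ∀ e : Sym2 V, ∃ f p : V × V, e ∈ Fs →
        s(f.1, f.2) = e ∧ p ∈ P ∧ Crit H.dist p f := by
      intro e
      by_cases he : e ∈ Fs
      · induction e using Sym2.ind with
        | _ a b =>
        have hab : H.Adj a b := he.1
        have hnT : ¬ T.Adj a b := he.2
        set H' := H.deleteEdges {s(a, b)} with hH'
        have hle : H' ≤ H := SimpleGraph.deleteEdges_le _
        have hTH' : T ≤ H' := by
          intro x y hxy
          rw [hH', SimpleGraph.deleteEdges_adj]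
          refine ⟨hTH hxy, ?_⟩
          rw [Set.mem_singleton_iff]
          intro h
          apply hnT
          have : s(x, y) ∈ T.edgeSet := hxy
          rw [h] at this
          exact this
        have hnot : ¬ (∀ p ∈ P, Wi H' p.1 p.2 (G.dist p.1 p.2)) := by
          intro hall
          have := hm ⟨hTH', hall⟩ hle hab
          rw [hH', SimpleGraph.deleteEdges_adj] at this
          exact this.2 rfl
        push Not at hnot
        obtain ⟨p, hp, hpn⟩ := hnot
        have hdist : G.dist p.1 p.2 = H.dist p.1 p.2 :=
          le_antisymm ((Wi.of_dist hHc _ _).dist_le_of_le hHG) (hHP p hp).dist_le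
        rw [hdist] at hpn
        obtain ⟨f, hf1, hf2⟩ := crit_of_delete hHc hab hpn
        exact ⟨f, p, fun _ => ⟨hf1, hp, hf2⟩⟩
      · obtain ⟨x, y⟩ := e
        exact ⟨(x, y), (x, y), fun h => absurd h he⟩
    choose orr qq hoq using hcrit
    have hfin : Fs.Finite := Set.toFinite _
    set F := hfin.toFinset.image orr with hF
    have hmemF : ∀ f ∈ F, s(f.1, f.2) ∈ Fs ∧ orr s(f.1, f.2) = f := by
      intro f hf
      rw [hF, Finset.mem_image] at hf
      obtain ⟨e, he, rfl⟩ := hf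
      rw [Set.Finite.mem_toFinset] at he
      rw [(hoq e he).1]
      exact ⟨he, rfl⟩
    have hcard : F.card = Fs.ncard := by
      rw [hF, Finset.card_image_of_injOn, Set.ncard_eq_toFinset_card Fs hfin]
      intro e he e' he' h
      rw [Set.Finite.coe_toFinset] at he he'
      rw [← (hoq e he).1, ← (hoq e' he').1, h]
    refine core_total (gmet_dist hHc) P F (fun f => qq s(f.1, f.2)) ?_ ?_ δ μ hδ hμ (by rw [hcard]; exact hlt)
    · intro f hf
      obtain ⟨h1, h2⟩ := hmemF f hf
      have := (hoq _ h1).2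
      rw [h2] at this
      exact this
    · intro a b h h'
      obtain ⟨h1, h2⟩ := hmemF _ h
      obtain ⟨h3, h4⟩ := hmemF _ h'
      simp only at h1 h2 h3 h4
      rw [Sym2.eq_swap, h2] at h4
      have : H.Adj a b := h1.1
      exact this.ne (Prod.mk.inj h4).1

theorem preserver_arith (n p m : ℕ) (hn : 1 ≤ n)
    (h : ∀ δ μ : ℕ, 1 ≤ δ → 1 ≤ μ → 2 * (δ + 1) * n + 3 * μ * p < m →
        (δ + 1) ^ 4 * μ ≤ 800 * p ^ 2) :
    (m : ℝ) ≤ 67 * ((n : ℝ) ^ (4 / 5 : ℝ) * (p : ℝ) ^ (3 / 5 : ℝ) + n + p) := by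
  have hnn : (0 : ℝ) ≤ (n : ℝ) ^ (4 / 5 : ℝ) * (p : ℝ) ^ (3 / 5 : ℝ) := by positivity
  have hn0 : (0 : ℝ) ≤ n := by positivity
  have hp0 : (0 : ℝ) ≤ p := by positivity
  by_cases h1 : m < 16 * n
  · have : (m : ℝ) < 16 * n := by exact_mod_cast h1
    nlinarith
  by_cases h2 : m < 12 * p
  · have : (m : ℝ) < 12 * p := by exact_mod_cast h2
    nlinarith
  push Not at h1 h2
  rcases Nat.eq_zero_or_pos p with rfl | hp
  · have := h 1 1 le_rfl le_rfl (by omega)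
    simp at this
  set a := m / (8 * n) with ha
  set b := m / (12 * p) with hb
  have ha2 : 2 ≤ a := by rw [ha, Nat.le_div_iff_mul_le (by omega)]; omega
  have hb1 : 1 ≤ b := by rw [hb, Nat.le_div_iff_mul_le (by omega)]; omega
  have ha3 : a * (8 * n) ≤ m := Nat.div_mul_le_self _ _
  have hb3 : b * (12 * p) ≤ m := Nat.div_mul_le_self _ _
  have hlt : 2 * (a - 1 + 1) * n + 3 * b * p < m := by
    have : a - 1 + 1 = a := by omega
    rw [this]; nlinarith
  have hk := h (a - 1) b (by omega) hb1 hlt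
  have : a - 1 + 1 = a := by omega
  rw [this] at hk
  have ha4 : m ≤ 16 * n * a := by
    have := Nat.lt_div_mul_add (a := m) (b := 8 * n) (by omega)
    rw [← ha] at this; nlinarith
  have hb4 : m ≤ 24 * p * b := by
    have := Nat.lt_div_mul_add (a := m) (b := 12 * p) (by omega)
    rw [← hb] at this; nlinarith
  have h5 : m ^ 5 ≤ 67 ^ 5 * (n ^ 4 * p ^ 3) := by
    calc m ^ 5 = m ^ 4 * m := by ring
      _ ≤ (16 * n * a) ^ 4 * (24 * p * b) := by gcongr
      _ = 16 ^ 4 * 24 * n ^ 4 * p * (a ^ 4 * b) := by ring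
      _ ≤ 16 ^ 4 * 24 * n ^ 4 * p * (800 * p ^ 2) := by gcongr
      _ = (16 ^ 4 * 24 * 800) * (n ^ 4 * p ^ 3) := by ring
      _ ≤ _ := by gcongr; norm_num
  have h6 : (m : ℝ) ^ 5 ≤ (67 * ((n : ℝ) ^ (4 / 5 : ℝ) * (p : ℝ) ^ (3 / 5 : ℝ))) ^ 5 := by
    rw [mul_pow, mul_pow, ← Real.rpow_natCast ((n : ℝ) ^ (4 / 5 : ℝ)),
      ← Real.rpow_natCast ((p : ℝ) ^ (3 / 5 : ℝ)), ← Real.rpow_mul hn0, ← Real.rpow_mul hp0]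
    norm_num
    have : (m : ℝ) ^ 5 ≤ 67 ^ 5 * (n ^ 4 * p ^ 3) := by exact_mod_cast h5
    norm_num at this
    exact this
  have := le_of_pow_le_pow_left₀ (by norm_num) (by positivity) h6
  nlinarith

theorem preserver {V : Type*} [Fintype V] {G : SimpleGraph V} (hG : G.Connected)
    (P : Finset (V × V)) : ∃ H ≤ G, (∀ p ∈ P, Wi H p.1 p.2 (G.dist p.1 p.2)) ∧
      (H.edgeSet.ncard : ℝ) ≤ 68 * ((Fintype.card V : ℝ) ^ (4 / 5 : ℝ) * (P.card : ℝ) ^ (3 / 5 : ℝ)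
        + Fintype.card V + P.card) := by
  obtain ⟨H, hH, h1, _, m, h2, h3⟩ := preserver_graph hG P
  refine ⟨H, hH, h1, ?_⟩
  have : Nonempty V := hG.nonempty
  have h4 := preserver_arith (Fintype.card V) P.card m Fintype.card_pos h3
  have h5 : (H.edgeSet.ncard : ℝ) ≤ Fintype.card V + m := by exact_mod_cast h2
  have : (0 : ℝ) ≤ (Fintype.card V : ℝ) ^ (4 / 5 : ℝ) * (P.card : ℝ) ^ (3 / 5 : ℝ) := by positivity
  have : (0 : ℝ) ≤ P.card := by positivity
  linarith


theorem ncard_sup_le {V : Type*} [Finite V] (H H' : SimpleGraph V) :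
    (H ⊔ H').edgeSet.ncard ≤ H.edgeSet.ncard + H'.edgeSet.ncard := by
  rw [SimpleGraph.edgeSet_sup]; exact Set.ncard_union_le _ _

theorem ncard_fsup_le {V ι : Type*} [Finite V] (s : Finset ι) (X : ι → SimpleGraph V) :
    (s.sup X).edgeSet.ncard ≤ ∑ i ∈ s, (X i).edgeSet.ncard := by
  classical
  induction s using Finset.induction_on with
  | empty => simp
  | insert a s ha ih =>
    rw [Finset.sup_insert, Finset.sum_insert ha]
    exact (ncard_sup_le _ _).trans (by omega)

theorem ncard_mono {V : Type*} [Finite V] {H H' : SimpleGraph V} (h : H ≤ H') :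
    H.edgeSet.ncard ≤ H'.edgeSet.ncard :=
  Set.ncard_le_ncard (SimpleGraph.edgeSet_subset_edgeSet.2 h) (Set.toFinite _)

theorem Wi.exists_sub {V : Type*} {G : SimpleGraph V} {u v : V} {k : ℕ} (h : Wi G u v k) :
    ∃ X ≤ G, X.edgeSet.ncard ≤ k ∧ Wi X u v k := by
  classical
  obtain ⟨p, hp⟩ := h
  refine ⟨SimpleGraph.fromEdgeSet {e | e ∈ p.edges}, ?_, ?_, ?_⟩
  · intro x y hxy
    rw [SimpleGraph.fromEdgeSet_adj] at hxy
    exact p.adj_of_mem_edges hxy.1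
  · have h1 : (SimpleGraph.fromEdgeSet {e | e ∈ p.edges}).edgeSet ⊆ (p.edges.toFinset : Set (Sym2 V)) := by
      rw [SimpleGraph.edgeSet_fromEdgeSet]
      intro e he
      simpa using he.1
    calc _ ≤ (p.edges.toFinset : Set (Sym2 V)).ncard := Set.ncard_le_ncard h1 (Finset.finite_toSet _)
      _ = p.edges.toFinset.card := Set.ncard_coe_finset _
      _ ≤ p.edges.length := List.toFinset_card_le _
      _ ≤ k := by rw [SimpleGraph.Walk.length_edges]; exact hp
  · have hh : ∀ e ∈ p.edges, e ∈ (SimpleGraph.fromEdgeSet {e | e ∈ p.edges}).edgeSet := by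
      intro e he
      rw [SimpleGraph.edgeSet_fromEdgeSet]
      exact ⟨he, G.not_isDiag_of_mem_edgeSet (p.edges_subset_edgeSet he)⟩
    exact ⟨p.transfer _ hh, by rw [SimpleGraph.Walk.length_transfer]; exact hp⟩

theorem geo_exists {V : Type*} {G : SimpleGraph V} (hG : G.Connected) (u v : V) :
    ∃ γ : ℕ → V, γ 0 = u ∧ γ (G.dist u v) = v ∧
      (∀ i < G.dist u v, G.Adj (γ i) (γ (i + 1))) ∧
      ∀ i j, i ≤ j → j ≤ G.dist u v → i + G.dist (γ i) (γ j) = j := by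
  obtain ⟨p, hp⟩ := (hG u v).exists_walk_length_eq_dist
  have hv : p.getVert (G.dist u v) = v := by rw [← hp]; simp
  have hadj : ∀ i < G.dist u v, G.Adj (p.getVert i) (p.getVert (i + 1)) :=
    fun i hi => p.adj_getVert_succ (by omega)
  refine ⟨p.getVert, by simp, hv, hadj, ?_⟩
  have hup : ∀ i k, i + k ≤ G.dist u v → G.dist (p.getVert i) (p.getVert (i + k)) ≤ k := by
    intro i k
    induction k with
    | zero => simp
    | succ k ih =>
      intro h
      have h1 := ih (by omega)
      have h2 : G.dist (p.getVert (i + k)) (p.getVert (i + k + 1)) ≤ 1 :=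
        (Wi.adj (hadj (i + k) (by omega))).dist_le
      have := hG.dist_triangle (u := p.getVert i) (v := p.getVert (i + k)) (w := p.getVert (i + k + 1))
      rw [← add_assoc]; omega
  intro i j hij hj
  obtain ⟨k, rfl⟩ := Nat.exists_eq_add_of_le hij
  have h1 := hup i k hj
  have h2 := hup 0 i (by omega)
  have h3 := hup (i + k) (G.dist u v - (i + k)) (by omega)
  rw [show i + k + (G.dist u v - (i + k)) = G.dist u v by omega, hv] at h3
  simp only [zero_add, SimpleGraph.Walk.getVert_zero] at h2
  have t1 := hG.dist_triangle (u := u) (v := p.getVert i) (w := v)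
  have t2 := hG.dist_triangle (u := p.getVert i) (v := p.getVert (i + k)) (w := v)
  omega

open Finset in
theorem path_buy {V : Type*} [Fintype V] (G H₀ : SimpleGraph V) (hH₀ : H₀ ≤ G)
    (S W : Finset V) (Pr : Finset (V × V)) (hPr : ∀ p ∈ Pr, p.1 ∈ S ∧ p.2 ∈ S)
    (X : V × V → SimpleGraph V) (hubs : V × V → Finset V) (κ K : ℕ)
    (hX : ∀ p ∈ Pr, X p ≤ G ∧ (X p).edgeSet.ncard ≤ κ * #(hubs p) ∧ hubs p ⊆ W)
    (hgood : ∀ p ∈ Pr, ∀ h ∈ hubs p, Wi (H₀ ⊔ X p) p.1 h (G.dist p.1 h + K) ∧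
      Wi (H₀ ⊔ X p) h p.2 (G.dist h p.2 + K) ∧ G.dist p.1 h + G.dist h p.2 ≤ G.dist p.1 p.2 + K)
    (hend : ∀ p ∈ Pr, Wi (H₀ ⊔ X p) p.1 p.2 (G.dist p.1 p.2 + K)) :
    ∃ H, H₀ ≤ H ∧ H ≤ G ∧ H.edgeSet.ncard ≤ H₀.edgeSet.ncard + κ * (#S * #W) ∧
      ∀ p ∈ Pr, Wi H p.1 p.2 (G.dist p.1 p.2 + 3 * K) := by
  classical
  set HF : Finset (V × V) → SimpleGraph V := fun F => H₀ ⊔ F.sup X with hHF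
  set good : Finset (V × V) → Finset (V × V) := fun F =>
    {c ∈ S ×ˢ W | Wi (HF F) c.1 c.2 (G.dist c.1 c.2 + K)} with hgd
  obtain ⟨F, hF, hmax⟩ := exists_max_image
    ({F ∈ Pr.powerset | ∑ p ∈ F, #(hubs p) ≤ #(good F)}) (fun F => #F) ⟨∅, by simp⟩
  simp only [mem_filter, mem_powerset] at hF hmax
  obtain ⟨hFP, hFc⟩ := hF
  refine ⟨HF F, le_sup_left, sup_le hH₀ (Finset.sup_le fun p hp => (hX p (hFP hp)).1), ?_, ?_⟩
  · refine (ncard_sup_le _ _).trans (Nat.add_le_add_left ?_ _)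
    calc _ ≤ ∑ p ∈ F, (X p).edgeSet.ncard := ncard_fsup_le _ _
      _ ≤ ∑ p ∈ F, κ * #(hubs p) := sum_le_sum fun p hp => (hX p (hFP hp)).2.1
      _ = κ * ∑ p ∈ F, #(hubs p) := by rw [mul_sum]
      _ ≤ κ * #(good F) := by gcongr
      _ ≤ κ * (#S * #W) := by
        gcongr
        rw [← card_product]
        exact card_le_card (filter_subset _ _)
  · intro p hp
    by_contra hnot
    have hpF : p ∉ F := by
      intro h
      have hle : H₀ ⊔ X p ≤ HF F := sup_le_sup_left (Finset.le_sup h) _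
      exact hnot (((hend p hp).mono hle).le (by omega))
    have hmono : HF F ≤ HF (insert p F) := by
      simp only [hHF]; exact sup_le_sup_left (Finset.sup_mono (subset_insert _ _)) _
    have hple : H₀ ⊔ X p ≤ HF (insert p F) :=
      sup_le_sup_left (Finset.le_sup (mem_insert_self _ _)) _
    have hsub : good F ⊆ good (insert p F) := by
      intro c hc
      simp only [hgd, mem_filter] at hc ⊢
      exact ⟨hc.1, hc.2.mono hmono⟩
    have hnew : #(hubs p) ≤ #(good (insert p F) \ good F) := by
      refine card_le_card_of_injOn
        (fun h => if (p.1, h) ∈ good F then (p.2, h) else (p.1, h)) ?_ ?_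
      · intro h hh
        obtain ⟨g1, g2, g3⟩ := hgood p hp h hh
        have hW := (hX p hp).2.2 hh
        obtain ⟨hS1, hS2⟩ := hPr p hp
        have g2' := g2.symm
        rw [SimpleGraph.dist_comm] at g2'
        have m1 : (p.1, h) ∈ good (insert p F) := by
          simp only [hgd, mem_filter, mem_product]; exact ⟨⟨hS1, hW⟩, g1.mono hple⟩
        have m2 : (p.2, h) ∈ good (insert p F) := by
          simp only [hgd, mem_filter, mem_product]; exact ⟨⟨hS2, hW⟩, g2'.mono hple⟩
        simp only [coe_sdiff, Set.mem_sdiff, mem_coe]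
        split_ifs with hc
        · refine ⟨m2, fun hc2 => hnot ?_⟩
          simp only [hgd, mem_filter] at hc hc2
          have k1 := hc.2
          have k2 := hc2.2.symm
          rw [SimpleGraph.dist_comm] at k2
          exact (k1.trans k2).le (by omega)
        · exact ⟨m1, hc⟩
      · intro a _ b _ h
        simp only at h
        split_ifs at h <;> exact (Prod.mk.inj h).2
    have hsd : #(good (insert p F) \ good F) + #(good F) = #(good (insert p F)) :=
      card_sdiff_add_card_eq_card hsub
    have := hmax (insert p F) ⟨insert_subset hp hFP, by rw [sum_insert hpF]; omega⟩
    rw [card_insert_of_notMem hpF] at this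
    omega


open Finset in
theorem sep_exists {V : Type*} [Fintype V] {G : SimpleGraph V} (Hi : Finset V) :
    ∃ W ⊆ Hi, (∀ a ∈ W, ∀ b ∈ W, a ≠ b → 2 < G.dist a b) ∧
      ∀ v ∈ Hi, ∃ w ∈ W, G.dist v w ≤ 2 := by
  classical
  obtain ⟨W, hW, hmax⟩ := exists_max_image
    ({W ∈ Hi.powerset | ∀ a ∈ W, ∀ b ∈ W, a ≠ b → 2 < G.dist a b}) (fun W => #W) ⟨∅, by simp⟩
  simp only [mem_filter, mem_powerset] at hW hmax
  refine ⟨W, hW.1, hW.2, fun v hv => ?_⟩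
  by_contra hno
  push Not at hno
  have hvW : v ∉ W := fun h => by have := hno v h; simp at this
  have := hmax (insert v W) ⟨insert_subset hv hW.1, ?_⟩
  · rw [card_insert_of_notMem hvW] at this; omega
  · intro a ha b hb hab
    rw [mem_insert] at ha hb
    rcases ha with rfl | ha <;> rcases hb with rfl | hb
    · exact absurd rfl hab
    · exact hno b hb
    · rw [SimpleGraph.dist_comm]; exact hno a ha
    · exact hW.2 a ha b hb hab

open Finset in
theorem low_graph {V : Type*} [Fintype V] [DecidableEq V] (G : SimpleGraph V) [DecidableRel G.Adj]
    (Δ : ℕ) :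
    ∃ L ≤ G, L.edgeSet.ncard ≤ Fintype.card V * Δ ∧
      ∀ x y, G.Adj x y → G.degree x < Δ → L.Adj x y := by
  set E : Finset (Sym2 V) := ({v | G.degree v < Δ} : Finset V).biUnion
    fun v => (G.neighborFinset v).image fun y => s(v, y) with hE
  have hmem : ∀ e ∈ E, e ∈ G.edgeSet := by
    intro e he
    simp only [hE, mem_biUnion, mem_image, SimpleGraph.mem_neighborFinset] at he
    obtain ⟨v, _, y, hy, rfl⟩ := he
    exact hy
  refine ⟨SimpleGraph.fromEdgeSet (E : Set (Sym2 V)), ?_, ?_, ?_⟩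
  · intro x y h
    rw [SimpleGraph.fromEdgeSet_adj] at h
    exact hmem _ h.1
  · rw [SimpleGraph.edgeSet_fromEdgeSet]
    calc _ ≤ (E : Set (Sym2 V)).ncard := Set.ncard_le_ncard Set.sdiff_subset (Finset.finite_toSet _)
      _ = #E := Set.ncard_coe_finset _
      _ ≤ #({v | G.degree v < Δ} : Finset V) * Δ := by
        refine card_biUnion_le_card_mul _ _ _ fun v hv => ?_
        simp only [mem_filter, mem_univ, true_and] at hv
        refine card_image_le.trans ?_
        rw [SimpleGraph.card_neighborFinset_eq_degree]; omega
      _ ≤ _ := Nat.mul_le_mul_right _ (card_le_univ _)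
  · intro x y h hx
    rw [SimpleGraph.fromEdgeSet_adj]
    refine ⟨?_, h.ne⟩
    simp only [hE, coe_biUnion, Set.mem_iUnion, mem_coe, mem_image, SimpleGraph.mem_neighborFinset]
    exact ⟨x, by simpa using hx, y, h, rfl⟩

open Finset in
theorem subset_spanner {V : Type*} [Fintype V] {G : SimpleGraph V} (hG : G.Connected)
    (S : Finset V) (Δ : ℕ) (hΔ : 1 ≤ Δ) (hS : #S ≤ Δ ^ 2) :
    ∃ H ≤ G, (∀ a ∈ S, ∀ b ∈ S, Wi H a b (G.dist a b + 12)) ∧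
      H.edgeSet.ncard ≤ 8 * Fintype.card V * Δ := by
  classical
  set n := Fintype.card V with hn
  obtain ⟨L, hLG, hLc, hLadj⟩ := low_graph G Δ
  set Hi : Finset V := {v | Δ ≤ G.degree v} with hHi
  obtain ⟨W, hWHi, hWsep, hWcov⟩ := sep_exists (G := G) Hi
  have hWc : #W * Δ ≤ n := by
    have hdis : (W : Set V).PairwiseDisjoint (fun w => G.neighborFinset w) := by
      intro a ha b hb hab
      refine disjoint_left.2 fun y hy hy' => ?_
      rw [SimpleGraph.mem_neighborFinset] at hy hy'
      have h1 := ((Wi.adj hy).trans (Wi.adj hy').symm).dist_le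
      have := hWsep a ha b hb hab
      omega
    calc #W * Δ = #W • Δ := rfl
      _ ≤ ∑ w ∈ W, #(G.neighborFinset w) := card_nsmul_le_sum _ _ _ fun w hw => by
          have := hWHi hw
          simpa [hHi] using this
      _ = #(W.biUnion fun w => G.neighborFinset w) := (card_biUnion hdis).symm
      _ ≤ n := card_le_univ _
  have hst : ∀ v, ∃ c, ∃ Y : SimpleGraph V, Y ≤ G ∧ Y.edgeSet.ncard ≤ 2 ∧ (v ∈ Hi → c ∈ W ∧ G.dist v c ≤ 2 ∧ Wi Y v c 2) := by
    intro v
    by_cases h : v ∈ Hi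
    · obtain ⟨w, hw, hd⟩ := hWcov v h
      obtain ⟨Y, hY1, hY2, hY3⟩ := (Wi.of_dist_le hG hd).exists_sub
      exact ⟨w, Y, hY1, hY2, fun _ => ⟨hw, hd, hY3⟩⟩
    · exact ⟨v, ⊥, bot_le, by simp, fun h' => absurd h' h⟩
  choose cen Y hYG hYc hcen using hst
  set H₀ := L ⊔ (univ : Finset V).sup Y with hH₀
  have hH₀G : H₀ ≤ G := sup_le hLG (Finset.sup_le fun v _ => hYG v)
  have hH₀c : H₀.edgeSet.ncard ≤ n * Δ + n * 2 := by
    refine (ncard_sup_le _ _).trans (Nat.add_le_add hLc ?_)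
    refine (ncard_fsup_le _ _).trans ?_
    calc _ ≤ ∑ _v : V, 2 := sum_le_sum fun v _ => hYc v
      _ = n * 2 := by simp [hn]
  have hgeo := fun p : V × V => geo_exists hG p.1 p.2
  choose γ g0 gL gadj gd using hgeo
  set M : V × V → Finset ℕ := fun p =>
    {i ∈ range (G.dist p.1 p.2) | γ p i ∈ Hi ∧ γ p (i + 1) ∈ Hi} with hM
  have hMm : ∀ p, ∀ i ∈ M p, i < G.dist p.1 p.2 ∧ γ p i ∈ Hi := by
    intro p i hi
    simp only [hM, mem_filter, mem_range] at hi
    exact ⟨hi.1, hi.2.1⟩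
  have hed : ∀ p : V × V, ∀ i, ∃ Z : SimpleGraph V, Z ≤ G ∧ Z.edgeSet.ncard ≤ 1 ∧
      (i < G.dist p.1 p.2 → Wi Z (γ p i) (γ p (i + 1)) 1) := by
    intro p i
    by_cases h : i < G.dist p.1 p.2
    · obtain ⟨Z, h1, h2, h3⟩ := (Wi.adj (gadj p i h)).exists_sub
      exact ⟨Z, h1, h2, fun _ => h3⟩
    · exact ⟨⊥, bot_le, by simp, fun h' => absurd h' h⟩
  choose Z hZG hZc hZ using hed
  set X : V × V → SimpleGraph V := fun p => (M p).sup (Z p) with hX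
  set hubs : V × V → Finset V := fun p => (M p).image fun i => cen (γ p i) with hhubs
  have hMc : ∀ p, #(M p) ≤ 5 * #(hubs p) := by
    intro p
    refine card_le_mul_card_image_of_maps_to (f := fun i => cen (γ p i))
      (fun i hi => mem_image.2 ⟨i, hi, rfl⟩) 5 ?_
    intro c _
    set T := ({i ∈ M p | cen (γ p i) = c} : Finset ℕ) with hT
    rcases T.eq_empty_or_nonempty with h | h
    · rw [h]; simp
    · have hmin := T.min'_mem h
      set i₀ := T.min' h with hi₀
      have hsub : T ⊆ Icc i₀ (i₀ + 4) := by
        intro j hj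
        have hle : i₀ ≤ j := T.min'_le j hj
        rw [mem_Icc]
        refine ⟨hle, ?_⟩
        simp only [hT, mem_filter] at hj hmin
        obtain ⟨a1, a2⟩ := hMm p j hj.1
        obtain ⟨b1, b2⟩ := hMm p i₀ hmin.1
        have e1 := (hcen _ a2).2.1
        have e2 := (hcen _ b2).2.1
        rw [hj.2] at e1
        rw [hmin.2] at e2
        have t := hG.dist_triangle (u := γ p i₀) (v := c) (w := γ p j)
        have := SimpleGraph.dist_comm (G := G) (u := c) (v := γ p j)
        have := gd p i₀ j hle a1.le
        omega
      calc #T ≤ #(Icc i₀ (i₀ + 4)) := card_le_card hsub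
        _ = 5 := by simp; omega
  have hpath : ∀ p, ∀ i k, i + k ≤ G.dist p.1 p.2 → Wi (H₀ ⊔ X p) (γ p i) (γ p (i + k)) k := by
    intro p i k
    induction k with
    | zero => intro _; exact Wi.refl _ _
    | succ k ih =>
      intro h
      refine (ih (by omega)).trans (?_ : Wi _ (γ p (i + k)) (γ p (i + k + 1)) 1)
      have hadj := gadj p (i + k) (by omega)
      by_cases h1 : γ p (i + k) ∈ Hi
      · by_cases h2 : γ p (i + k + 1) ∈ Hi
        · refine (hZ p (i + k) (by omega)).mono (le_trans ?_ le_sup_right)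
          refine Finset.le_sup (f := Z p) ?_
          simp only [hM, mem_filter, mem_range]
          exact ⟨by omega, h1, h2⟩
        · have : L.Adj _ _ := hLadj _ _ hadj.symm (by simpa [hHi] using h2)
          exact (Wi.adj this).symm.mono (le_trans le_sup_left le_sup_left)
      · have : L.Adj _ _ := hLadj _ _ hadj (by simpa [hHi] using h1)
        exact (Wi.adj this).mono (le_trans le_sup_left le_sup_left)
  have hpb := path_buy G H₀ hH₀G S W (S ×ˢ S)
    (fun p hp => mem_product.1 hp) X hubs 5 4 ?_ ?_ ?_
  · obtain ⟨H, hH0, hHG, hHc, hHW⟩ := hpb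
    refine ⟨H, hHG, fun a ha b hb => hHW (a, b) (mem_product.2 ⟨ha, hb⟩), ?_⟩
    have h1 : #S * #W ≤ n * Δ := by
      calc #S * #W ≤ Δ ^ 2 * #W := by gcongr
        _ = (#W * Δ) * Δ := by ring
        _ ≤ n * Δ := by gcongr
    have h2 : n ≤ n * Δ := Nat.le_mul_of_pos_right _ hΔ
    nlinarith
  · intro p _
    refine ⟨Finset.sup_le fun i _ => hZG p i, ?_, ?_⟩
    · calc _ ≤ ∑ i ∈ M p, (Z p i).edgeSet.ncard := ncard_fsup_le _ _
        _ ≤ ∑ i ∈ M p, 1 := sum_le_sum fun i _ => hZc p i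
        _ = #(M p) := by simp
        _ ≤ _ := hMc p
    · intro h hh
      simp only [hhubs, mem_image] at hh
      obtain ⟨i, hi, rfl⟩ := hh
      exact (hcen _ (hMm p i hi).2).1
  · intro p _ h hh
    simp only [hhubs, mem_image] at hh
    obtain ⟨i, hi, rfl⟩ := hh
    obtain ⟨hi1, hi2⟩ := hMm p i hi
    obtain ⟨c1, c2, c3⟩ := hcen _ hi2
    set c := cen (γ p i)
    have w1 := hpath p 0 i (by omega)
    have w2 := hpath p i (G.dist p.1 p.2 - i) (by omega)
    rw [zero_add, g0] at w1
    rw [show i + (G.dist p.1 p.2 - i) = G.dist p.1 p.2 by omega, gL] at w2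
    have w3 : Wi (H₀ ⊔ X p) (γ p i) c 2 :=
      c3.mono (le_trans (Finset.le_sup (mem_univ _)) (le_trans le_sup_right le_sup_left))
    have e1 := gd p 0 i (by omega) (by omega)
    have e2 := gd p i (G.dist p.1 p.2) (by omega) le_rfl
    rw [g0] at e1
    rw [gL] at e2
    have s1 := SimpleGraph.dist_comm (G := G) (u := γ p i) (v := c)
    have t1 := hG.dist_triangle (u := p.1) (v := c) (w := γ p i)
    have t2 := hG.dist_triangle (u := γ p i) (v := c) (w := p.2)
    have t3 := hG.dist_triangle (u := p.1) (v := γ p i) (w := c)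
    have t4 := hG.dist_triangle (u := c) (v := γ p i) (w := p.2)
    refine ⟨(w1.trans w3).le (by omega), (w3.symm.trans w2).le (by omega), by omega⟩
  · intro p _
    have := hpath p 0 (G.dist p.1 p.2) (by omega)
    rw [zero_add, g0, gL] at this
    exact this.le (by omega)


/-- closed ball in the graph metric -/
noncomputable def gball {V : Type*} [Fintype V] (G : SimpleGraph V) (c : V) (ρ : ℕ) : Finset V :=
  Finset.univ.filter fun v => G.dist c v ≤ ρ

theorem mem_gball {V : Type*} [Fintype V] {G : SimpleGraph V} {c v : V} {ρ : ℕ} :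
    v ∈ gball G c ρ ↔ G.dist c v ≤ ρ := by simp [gball]

theorem gball_mono {V : Type*} [Fintype V] {G : SimpleGraph V} {c : V} {ρ ρ' : ℕ} (h : ρ ≤ ρ') :
    gball G c ρ ⊆ gball G c ρ' := by
  intro v hv
  rw [mem_gball] at *
  omega

theorem induce_path {V : Type*} {G : SimpleGraph V} (X : Set V) (γ : ℕ → V) (L : ℕ)
    (hadj : ∀ i < L, G.Adj (γ i) (γ (i + 1))) (hX : ∀ i ≤ L, γ i ∈ X) :
    ∀ k (hk : k ≤ L), Wi (G.induce X) ⟨γ 0, hX 0 (Nat.zero_le _)⟩ ⟨γ k, hX k hk⟩ k := by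
  intro k
  induction k with
  | zero => intro _; exact Wi.refl _ _
  | succ k ih =>
    intro hk
    refine (ih (by omega)).trans (Wi.adj ?_)
    exact hadj k (by omega)

theorem arena_wi {V : Type*} {G : SimpleGraph V} (hG : G.Connected) (c : V) (y : ℕ) (X : Set V)
    (hX : ∀ v, v ∈ X ↔ G.dist c v ≤ 2 * y) (a b : V) (ha : G.dist c a ≤ y) (hb : G.dist c b ≤ y)
    (ha' : a ∈ X) (hb' : b ∈ X) :
    Wi (G.induce X) ⟨a, ha'⟩ ⟨b, hb'⟩ (G.dist a b) := by
  obtain ⟨γ, g0, gL, gadj, gd⟩ := geo_exists hG a b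
  have hin : ∀ i ≤ G.dist a b, γ i ∈ X := by
    intro i hi
    rw [hX]
    have e1 := gd 0 i (by omega) hi
    have e2 := gd i _ hi le_rfl
    rw [g0] at e1
    rw [gL] at e2
    have t1 := hG.dist_triangle (u := c) (v := a) (w := γ i)
    have t2 := hG.dist_triangle (u := c) (v := b) (w := γ i)
    have s1 := SimpleGraph.dist_comm (G := G) (u := b) (v := γ i)
    have s2 := SimpleGraph.dist_comm (G := G) (u := c) (v := a)
    have t3 := hG.dist_triangle (u := a) (v := c) (w := b)
    omega
  have := induce_path X γ _ gadj hin _ le_rfl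
  convert this using 2
  · exact g0.symm
  · exact gL.symm

theorem arena_conn {V : Type*} {G : SimpleGraph V} (hG : G.Connected) (c : V) (y : ℕ) (X : Set V)
    (hX : ∀ v, v ∈ X ↔ G.dist c v ≤ y) : (G.induce X).Connected := by
  have hc : c ∈ X := by rw [hX]; simp
  have key : ∀ v : X, Wi (G.induce X) ⟨c, hc⟩ v (G.dist c v) := by
    rintro ⟨v, hv⟩
    obtain ⟨γ, g0, gL, gadj, gd⟩ := geo_exists hG c v
    have hin : ∀ i ≤ G.dist c v, γ i ∈ X := by
      intro i hi
      rw [hX]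
      have e1 := gd 0 i (by omega) hi
      rw [g0] at e1
      have := (hX v).1 hv
      omega
    have := induce_path X γ _ gadj hin _ le_rfl
    convert this using 2
    · exact g0.symm
    · exact gL.symm
  have : Nonempty X := ⟨⟨c, hc⟩⟩
  exact SimpleGraph.Connected.mk fun u v => (key u).reachable.symm.trans (key v).reachable

theorem arena_map {V : Type*} {G : SimpleGraph V} (X : Set V) (H' : SimpleGraph X)
    (h : H' ≤ G.induce X) : ∃ H ≤ G, H.edgeSet.ncard = H'.edgeSet.ncard ∧
      ∀ u v k, Wi H' u v k → Wi H u.1 v.1 k := by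
  refine ⟨H'.map (Function.Embedding.subtype _), ?_, ?_, ?_⟩
  · rw [SimpleGraph.map_le_iff_le_comap]
    exact h
  · rw [SimpleGraph.edgeSet_map]
    exact Set.ncard_image_of_injective _ (Function.Embedding.injective _)
  · rintro u v k ⟨p, hp⟩
    exact ⟨p.map (SimpleGraph.Embedding.map (Function.Embedding.subtype _) H').toHom,
      (SimpleGraph.Walk.length_map _ _).trans_le hp⟩

open Finset in
theorem arena_preserver {V : Type*} [Fintype V] {G : SimpleGraph V} (hG : G.Connected) (c : V)
    (y : ℕ) (P : Finset (V × V)) (hP : ∀ p ∈ P, G.dist c p.1 ≤ y ∧ G.dist c p.2 ≤ y) :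
    ∃ H ≤ G, (∀ p ∈ P, Wi H p.1 p.2 (G.dist p.1 p.2)) ∧
      (H.edgeSet.ncard : ℝ) ≤ 68 * ((#(gball G c (2 * y)) : ℝ) ^ (4 / 5 : ℝ) * (#P : ℝ) ^ (3 / 5 : ℝ)
        + #(gball G c (2 * y)) + #P) := by
  classical
  set X : Set V := (gball G c (2 * y) : Set V) with hXd
  have hX : ∀ v, v ∈ X ↔ G.dist c v ≤ 2 * y := fun v => by rw [hXd, mem_coe, mem_gball]
  have hconn := arena_conn hG c _ X hX
  set P' : Finset (X × X) := {p | (p.1.1, p.2.1) ∈ P} with hP'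
  obtain ⟨H', hle, hW, hc⟩ := preserver hconn P'
  obtain ⟨H, hH, hHc, hHW⟩ := arena_map X H' hle
  have hcX : Fintype.card X = #(gball G c (2 * y)) := by simp [hXd]
  have hPc : #P' ≤ #P := by
    refine card_le_card_of_injOn (fun p => (p.1.1, p.2.1)) (fun p hp => ?_) ?_
    · simpa [hP'] using hp
    · rintro ⟨a, b⟩ _ ⟨a', b'⟩ _ h
      simp only [Prod.mk.injEq] at h
      exact Prod.ext (Subtype.ext h.1) (Subtype.ext h.2)
  refine ⟨H, hH, ?_, ?_⟩
  · rintro ⟨a, b⟩ hp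
    obtain ⟨ha, hb⟩ := hP _ hp
    simp only at ha hb
    have ha' : a ∈ X := by rw [hX]; omega
    have hb' : b ∈ X := by rw [hX]; omega
    have h1 := hW (⟨a, ha'⟩, ⟨b, hb'⟩) (by simpa [hP'] using hp)
    have h2 := (arena_wi hG c y X hX a b ha hb ha' hb').dist_le
    exact (hHW _ _ _ h1).le h2
  · rw [hHc]
    refine hc.trans ?_
    rw [hcX]
    have : (#P' : ℝ) ≤ #P := by exact_mod_cast hPc
    gcongr

open Finset in
theorem arena_subset {V : Type*} [Fintype V] {G : SimpleGraph V} (hG : G.Connected) (c : V)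
    (y : ℕ) (S : Finset V) (hS : ∀ a ∈ S, G.dist c a ≤ y) (Δ : ℕ) (hΔ : 1 ≤ Δ) (hSc : #S ≤ Δ ^ 2) :
    ∃ H ≤ G, (∀ a ∈ S, ∀ b ∈ S, Wi H a b (G.dist a b + 12)) ∧
      H.edgeSet.ncard ≤ 8 * #(gball G c (2 * y)) * Δ := by
  classical
  set X : Set V := (gball G c (2 * y) : Set V) with hXd
  have hX : ∀ v, v ∈ X ↔ G.dist c v ≤ 2 * y := fun v => by rw [hXd, mem_coe, mem_gball]
  have hconn := arena_conn hG c _ X hX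
  set S' : Finset X := {p | p.1 ∈ S} with hS'
  have hSc' : #S' ≤ #S := by
    refine card_le_card_of_injOn (fun p => p.1) (fun p hp => ?_) ?_
    · simpa [hS'] using hp
    · intro a _ b _ h
      exact Subtype.ext h
  obtain ⟨H', hle, hW, hc⟩ := subset_spanner hconn S' Δ hΔ (hSc'.trans hSc)
  obtain ⟨H, hH, hHc, hHW⟩ := arena_map X H' hle
  have hcX : Fintype.card X = #(gball G c (2 * y)) := by simp [hXd]
  refine ⟨H, hH, ?_, ?_⟩
  · intro a has b hbs
    have ha := hS a has
    have hb := hS b hbs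
    have ha' : a ∈ X := by rw [hX]; omega
    have hb' : b ∈ X := by rw [hX]; omega
    have h1 := hW ⟨a, ha'⟩ (by simpa [hS'] using has) ⟨b, hb'⟩ (by simpa [hS'] using hbs)
    have h2 := (arena_wi hG c y X hX a b ha hb ha' hb').dist_le
    exact (hHW _ _ _ h1).le (by omega)
  · rw [hHc, ← hcX]; exact hc

open Finset in
theorem ball_tree {V : Type*} [Fintype V] {G : SimpleGraph V} (hG : G.Connected) (c : V) (y : ℕ) :
    ∃ H ≤ G, (∀ a, G.dist c a ≤ y → Wi H c a (G.dist c a)) ∧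
      H.edgeSet.ncard ≤ #(gball G c y) := by
  classical
  have hpar : ∀ v, ∃ w, v ≠ c → G.Adj w v ∧ G.dist c w + 1 = G.dist c v := by
    intro v
    by_cases h : v = c
    · exact ⟨v, fun h' => absurd h h'⟩
    · obtain ⟨γ, g0, gL, gadj, gd⟩ := geo_exists hG c v
      have hpos : G.dist c v ≠ 0 := fun h0 => h (hG.dist_eq_zero_iff.1 h0).symm
      refine ⟨γ (G.dist c v - 1), fun _ => ⟨?_, ?_⟩⟩
      · have := gadj (G.dist c v - 1) (by omega)
        rwa [show G.dist c v - 1 + 1 = G.dist c v by omega, gL] at this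
      · have := gd 0 (G.dist c v - 1) (by omega) (by omega)
        rw [g0] at this; omega
  choose par hpar using hpar
  set E : Finset (Sym2 V) := ((gball G c y).erase c).image fun v => s(par v, v) with hE
  refine ⟨SimpleGraph.fromEdgeSet (E : Set (Sym2 V)), ?_, ?_, ?_⟩
  · intro x z h
    rw [SimpleGraph.fromEdgeSet_adj] at h
    have h1 := h.1
    simp only [hE, mem_coe, mem_image, mem_erase] at h1
    obtain ⟨v, ⟨hv, _⟩, he⟩ := h1
    have : s(par v, v) ∈ G.edgeSet := (hpar v hv).1
    rw [he] at this
    exact this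
  · have : ∀ k, ∀ a, G.dist c a = k → k ≤ y →
        Wi (SimpleGraph.fromEdgeSet (E : Set (Sym2 V))) c a k := by
      intro k
      induction k with
      | zero =>
        intro a ha _
        have := hG.dist_eq_zero_iff.1 ha
        subst this
        exact Wi.refl _ _
      | succ k ih =>
        intro a ha hk
        have hne : a ≠ c := by rintro rfl; simp at ha
        obtain ⟨h1, h2⟩ := hpar a hne
        refine (ih (par a) (by omega) (by omega)).trans (Wi.adj ?_)
        rw [SimpleGraph.fromEdgeSet_adj]
        refine ⟨?_, h1.ne⟩
        simp only [hE, mem_coe, mem_image, mem_erase]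
        exact ⟨a, ⟨hne, by rw [mem_gball]; omega⟩, rfl⟩
    intro a ha
    exact this _ a rfl ha
  · rw [SimpleGraph.edgeSet_fromEdgeSet]
    calc _ ≤ (E : Set (Sym2 V)).ncard := Set.ncard_le_ncard Set.sdiff_subset (Finset.finite_toSet _)
      _ = #E := Set.ncard_coe_finset _
      _ ≤ #((gball G c y).erase c) := card_image_le
      _ ≤ _ := card_le_card (erase_subset _ _)


open Finset in
theorem radius_exists {V : Type*} [Fintype V] (G : SimpleGraph V) (r k : ℕ) (hk : 1 ≤ k) (v : V) :
    ∃ j < k, (#(gball G v (r * 6 ^ (j + 1))) : ℝ) ≤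
      (Fintype.card V : ℝ) ^ (1 / (k : ℝ)) * #(gball G v (r * 6 ^ j)) := by
  by_contra! hcon
  set n : ℝ := (Fintype.card V : ℝ) with hn
  have hn0 : 0 ≤ n := by positivity
  set q : ℝ := n ^ (1 / (k : ℝ)) with hq
  have hq0 : 0 ≤ q := by positivity
  have hpos : ∀ ρ, 1 ≤ (#(gball G v ρ) : ℝ) := by
    intro ρ
    have : 0 < #(gball G v ρ) := card_pos.2 ⟨v, by rw [mem_gball]; simp⟩
    exact_mod_cast this
  have key : ∀ j ≤ k, q ^ j ≤ #(gball G v (r * 6 ^ j)) ∧ (1 ≤ j → q ^ j < #(gball G v (r * 6 ^ j))) := by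
    intro j
    induction j with
    | zero => intro _; simpa using hpos r
    | succ j ih =>
      intro hj
      have h1 := (ih (by omega)).1
      have h2 := hcon j (by omega)
      have : q ^ (j + 1) < #(gball G v (r * 6 ^ (j + 1))) := by
        calc q ^ (j + 1) = q * q ^ j := by ring
          _ ≤ q * #(gball G v (r * 6 ^ j)) := by gcongr
          _ < _ := h2
      exact ⟨this.le, fun _ => this⟩
  have h := (key k le_rfl).2 hk
  have hqk : q ^ k = n := by
    rw [hq, ← Real.rpow_natCast, ← Real.rpow_mul hn0]
    have : (k : ℝ) ≠ 0 := by positivity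
    rw [one_div_mul_cancel this, Real.rpow_one]
  rw [hqk, hn] at h
  have h3 : #(gball G v (r * 6 ^ k)) ≤ Fintype.card V := card_le_univ _
  have h4 : Fintype.card V < #(gball G v (r * 6 ^ k)) := by exact_mod_cast h
  omega

/-- sphere in the graph metric -/
noncomputable def gsph {V : Type*} [Fintype V] (G : SimpleGraph V) (c : V) (ρ : ℕ) : Finset V :=
  Finset.univ.filter fun v => G.dist c v = ρ

theorem mem_gsph {V : Type*} [Fintype V] {G : SimpleGraph V} {c v : V} {ρ : ℕ} :
    v ∈ gsph G c ρ ↔ G.dist c v = ρ := by simp [gsph]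

open Finset in
theorem level_exists {V : Type*} [Fintype V] (G : SimpleGraph V) (c : V) (x : ℕ) (hx : 1 ≤ x) :
    ∃ l, 2 * x + 1 ≤ l ∧ l ≤ 3 * x ∧ #(gsph G c l) * x ≤ #(gball G c (6 * x)) := by
  classical
  by_contra! hcon
  have h1 : ∑ l ∈ Icc (2 * x + 1) (3 * x), #(gsph G c l) ≤ #(gball G c (6 * x)) := by
    rw [← card_biUnion]
    · apply card_le_card
      intro v hv
      simp only [mem_biUnion, mem_Icc, mem_gsph] at hv
      obtain ⟨l, hl, h⟩ := hv
      rw [mem_gball]; omega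
    · intro a _ b _ hab
      rw [Function.onFun, disjoint_left]
      intro v hv hv'
      rw [mem_gsph] at hv hv'
      exact hab (hv.symm.trans hv')
  have h2 : ∑ l ∈ Icc (2 * x + 1) (3 * x), #(gball G c (6 * x)) <
      ∑ l ∈ Icc (2 * x + 1) (3 * x), #(gsph G c l) * x := by
    apply sum_lt_sum_of_nonempty
    · exact ⟨2 * x + 1, by simp; omega⟩
    · intro l hl
      rw [mem_Icc] at hl
      exact hcon l hl.1 hl.2
  rw [sum_const, ← sum_mul, Nat.card_Icc, smul_eq_mul,
    show 3 * x + 1 - (2 * x + 1) = x by omega] at h2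
  nlinarith

open Finset in
theorem cover_exists {V : Type*} [Fintype V] {G : SimpleGraph V} (hG : G.Connected) (r k : ℕ)
    (hr : 1 ≤ r) (hk : 1 ≤ k) :
    ∃ (C : Finset V) (home : V → V) (x l : V → ℕ),
      (∀ v, home v ∈ C ∧ G.dist (home v) v ≤ 2 * x (home v)) ∧
      (∀ c, r ≤ x c ∧ x c ≤ r * 6 ^ k ∧ 2 * x c + 1 ≤ l c ∧ l c ≤ 3 * x c ∧
        #(gsph G c (l c)) * r ≤ #(gball G c (6 * x c))) ∧
      (∑ c ∈ C, (#(gball G c (6 * x c)) : ℝ)) ≤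
        (Fintype.card V : ℝ) ^ (1 / (k : ℝ)) * Fintype.card V := by
  classical
  choose j hjk hj using radius_exists G r k hk
  set x : V → ℕ := fun v => r * 6 ^ j v with hx
  have hxr : ∀ c, r ≤ x c := fun c => Nat.le_mul_of_pos_right _ (by positivity)
  choose l hl1 hl2 hl3 using fun c => level_exists G c (x c) (by have := hxr c; omega)
  obtain ⟨u, -, hdis, hcov⟩ := Vitali.exists_disjoint_subfamily_covering_enlargement
    (fun v => (gball G v (x v) : Set V)) Set.univ (fun v => (6 : ℝ) ^ j v) 2 (by norm_num)
    (fun a _ => by positivity) (6 ^ k)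
    (fun a _ => pow_le_pow_right₀ (by norm_num) (hjk a).le)
    (fun a _ => ⟨a, by rw [mem_coe, mem_gball]; simp⟩)
  have hcov' : ∀ v, ∃ c ∈ u, G.dist c v ≤ 2 * x c := by
    intro v
    obtain ⟨c, hc, ⟨w, hw1, hw2⟩, hle⟩ := hcov v trivial
    refine ⟨c, hc, ?_⟩
    rw [mem_coe, mem_gball] at hw1 hw2
    have hjj : j v ≤ j c := by
      by_contra! hlt
      have h1 : (6 : ℝ) ^ (j c + 1) ≤ 6 ^ j v := pow_le_pow_right₀ (by norm_num) hlt
      rw [pow_succ] at h1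
      have : (0 : ℝ) < 6 ^ j c := by positivity
      linarith
    have hxx : x v ≤ x c := Nat.mul_le_mul_left _ (Nat.pow_le_pow_right (by norm_num) hjj)
    have t := hG.dist_triangle (u := c) (v := w) (w := v)
    rw [SimpleGraph.dist_comm (u := w) (v := v)] at t
    omega
  choose home hh1 hh2 using hcov'
  refine ⟨univ.filter (· ∈ u), home, x, l, fun v => ⟨by simpa using hh1 v, hh2 v⟩,
    fun c => ⟨hxr c, ?_, hl1 c, hl2 c, ?_⟩, ?_⟩
  · exact Nat.mul_le_mul_left _ (Nat.pow_le_pow_right (by norm_num) (hjk c).le)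
  · exact (Nat.mul_le_mul_left _ (hxr c)).trans (hl3 c)
  · calc ∑ c ∈ univ.filter (· ∈ u), (#(gball G c (6 * x c)) : ℝ)
        ≤ ∑ c ∈ univ.filter (· ∈ u), (Fintype.card V : ℝ) ^ (1 / (k : ℝ)) * #(gball G c (x c)) := by
          refine sum_le_sum fun c _ => ?_
          have := hj c
          rwa [pow_succ, ← mul_assoc, mul_comm _ 6] at this
      _ = (Fintype.card V : ℝ) ^ (1 / (k : ℝ)) * ((∑ c ∈ univ.filter (· ∈ u), #(gball G c (x c)) : ℕ) : ℝ) := by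
          rw [← mul_sum]; push_cast; rfl
      _ ≤ _ := by
          gcongr
          rw [← card_biUnion]
          · exact card_le_univ _
          · intro a ha b hb hab
            have ha' : a ∈ u := by simpa using ha
            have hb' : b ∈ u := by simpa using hb
            exact disjoint_coe.1 (hdis ha' hb' hab)


theorem route_exists {V : Type*} {G : SimpleGraph V} (hG : G.Connected) (home : V → V)
    (x l : V → ℕ) (h1 : ∀ v, G.dist (home v) v ≤ 2 * x (home v)) (h2 : ∀ c, 2 * x c + 1 ≤ l c)
    (u v : V) : ∃ (m : ℕ) (t : ℕ → ℕ) (b : ℕ → V), b 0 = u ∧ b m = v ∧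
      (∀ i j, i ≤ j → j ≤ m → t i + G.dist (b i) (b j) = t j) ∧
      (∀ i < m, G.dist (home (b i)) (b (i + 1)) ≤ l (home (b i))) ∧
      (∀ i, i + 1 < m → G.dist (home (b i)) (b (i + 1)) = l (home (b i))) ∧
      (∀ i j, i < j → j < m → home (b i) ≠ home (b j)) := by
  classical
  obtain ⟨γ, g0, gL, gadj, gd⟩ := geo_exists hG u v
  set L := G.dist u v with hL
  set P : ℕ → ℕ → Prop := fun t t' => G.dist (home (γ t)) (γ t') ≤ l (home (γ t)) with hP
  set nx : ℕ → ℕ := fun t => Nat.findGreatest (P t) L with hnx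
  have step : ∀ c s, s < L → G.dist c (γ (s + 1)) ≤ G.dist c (γ s) + 1 := by
    intro c s hs
    have e := (Wi.adj (gadj s hs)).dist_le
    have := hG.dist_triangle (u := c) (v := γ s) (w := γ (s + 1))
    omega
  have nxle : ∀ t, nx t ≤ L := fun t => Nat.findGreatest_le _
  have Pself : ∀ t, P t t := fun t => by
    have a := h1 (γ t); have b := h2 (home (γ t)); simp only [hP]; omega
  have nxge : ∀ t ≤ L, t ≤ nx t := fun t ht => Nat.le_findGreatest ht (Pself t)
  have nxgt : ∀ t < L, t + 1 ≤ nx t := fun t ht => by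
    apply Nat.le_findGreatest ht
    have a := h1 (γ t); have b := h2 (home (γ t)); have c := step (home (γ t)) t ht
    show G.dist (home (γ t)) (γ (t + 1)) ≤ _
    omega
  have nxP : ∀ t ≤ L, P t (nx t) := fun t ht => Nat.findGreatest_spec ht (Pself t)
  have nxn : ∀ t s, nx t < s → s ≤ L → ¬ P t s := fun t s hs hsL =>
    Nat.findGreatest_is_greatest hs hsL
  have nxeq : ∀ t ≤ L, nx t < L → G.dist (home (γ t)) (γ (nx t)) = l (home (γ t)) := by
    intro t ht hlt
    have a := nxP t ht
    have b := nxn t (nx t + 1) (by omega) hlt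
    have c := step (home (γ t)) (nx t) hlt
    simp only [hP] at a b
    omega
  set T : ℕ → ℕ := fun i => nx^[i] 0 with hT
  have Ts : ∀ i, T (i + 1) = nx (T i) := fun i => Function.iterate_succ_apply' _ _ _
  have TL : ∀ i, T i ≤ L := by
    intro i
    cases i with
    | zero => simp [hT]
    | succ i => rw [Ts]; exact nxle _
  have Tmono : Monotone T := monotone_nat_of_le_succ fun i => by rw [Ts]; exact nxge _ (TL i)
  have Tge : ∀ i, i ≤ T i ∨ T i = L := by
    intro i
    induction i with
    | zero => left; simp
    | succ i ih =>
      rcases (TL i).lt_or_eq with h | h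
      · have := nxgt _ h
        rw [← Ts] at this
        left; omega
      · right
        have := Tmono (Nat.le_succ i)
        have := TL (i + 1)
        simp only [Nat.succ_eq_add_one] at *
        omega
  have hex : ∃ i, T i = L := ⟨L, by rcases Tge L with h | h <;> have := TL L <;> omega⟩
  have hm := Nat.find_spec hex
  have hmin : ∀ i < Nat.find hex, T i < L := fun i hi =>
    lt_of_le_of_ne (TL i) (Nat.find_min hex hi)
  refine ⟨Nat.find hex, T, fun i => γ (T i), g0, ?_, ?_, ?_, ?_, ?_⟩
  · simp only [hm, gL]
  · intro i j hij _
    exact gd _ _ (Tmono hij) (TL j)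
  · intro i _
    simp only [Ts]
    exact nxP _ (TL i)
  · intro i hi
    have := hmin _ hi
    simp only [Ts] at this ⊢
    exact nxeq _ (TL i) this
  · intro i j hij hj heq
    have hjL := hmin j hj
    have hT1 : T (i + 1) ≤ T j := Tmono hij
    have a := h1 (γ (T j))
    simp only at heq
    rw [← heq] at a
    have b := h2 (home (γ (T i)))
    rcases hT1.lt_or_eq with h | h
    · rw [Ts] at h
      have := nxn _ _ h hjL.le
      simp only [hP] at this
      omega
    · rw [← h] at hjL a
      rw [Ts] at hjL a
      have := nxeq _ (TL i) hjL
      omega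


structure IsRoute {V : Type*} (G : SimpleGraph V) (home : V → V) (l : V → ℕ) (u v : V) (m : ℕ)
    (t : ℕ → ℕ) (b : ℕ → V) : Prop where
  b0 : b 0 = u
  bm : b m = v
  add : ∀ i j, i ≤ j → j ≤ m → t i + G.dist (b i) (b j) = t j
  stp : ∀ i < m, G.dist (home (b i)) (b (i + 1)) ≤ l (home (b i))
  gen : ∀ i, i + 1 < m → G.dist (home (b i)) (b (i + 1)) = l (home (b i))
  inj : ∀ i j, i < j → j < m → home (b i) ≠ home (b j)

theorem IsRoute.split {V : Type*} {G : SimpleGraph V} {home : V → V} {l : V → ℕ} {u v : V} {m : ℕ}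
    {t : ℕ → ℕ} {b : ℕ → V} (h : IsRoute G home l u v m t b) {i j k : ℕ} (hij : i ≤ j)
    (hjk : j ≤ k) (hk : k ≤ m) :
    G.dist (b i) (b j) + G.dist (b j) (b k) = G.dist (b i) (b k) := by
  have h1 := h.add i j hij (by omega)
  have h2 := h.add j k hjk hk
  have h3 := h.add i k (by omega) hk
  omega

theorem IsRoute.injOn {V : Type*} {G : SimpleGraph V} {home : V → V} {l : V → ℕ} {u v : V} {m : ℕ}
    {t : ℕ → ℕ} {b : ℕ → V} (h : IsRoute G home l u v m t b) {i j : ℕ} (hi : i < m) (hj : j < m)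
    (e : home (b i) = home (b j)) : i = j := by
  rcases lt_trichotomy i j with h1 | h1 | h1
  · exact absurd e (h.inj i j h1 hj)
  · exact h1
  · exact absurd e.symm (h.inj j i h1 hi)

structure Base {V : Type*} (G H₀ : SimpleGraph V) (home : V → V) (l : V → ℕ) (R : ℕ)
    (ex md : V → Prop) : Prop where
  le : H₀ ≤ G
  conn : G.Connected
  self : ∀ v, G.dist (home v) v ≤ l (home v)
  tree : ∀ v w, G.dist (home v) w ≤ l (home v) → Wi H₀ (home v) w R
  exa : ∀ u v w, ex (home v) → G.dist (home u) v = l (home u) →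
    G.dist (home v) w = l (home v) → Wi H₀ v w (G.dist v w)
  mid : ∀ u v w, md (home v) → G.dist (home u) v = l (home u) →
    G.dist (home v) w = l (home v) → Wi H₀ v w (G.dist v w + 12)

open Classical in
/-- error allowance of a step -/
noncomputable def ste (R m : ℕ) (M : ℕ → Prop) (i : ℕ) : ℕ :=
  (if i = 0 then 2 * R else 0) + (if i + 1 = m then 2 * R else 0) + (if M i then 12 else 0)

section
variable {V : Type*} {G H₀ : SimpleGraph V} {home : V → V} {l : V → ℕ} {R : ℕ}
    {ex md : V → Prop} {u v : V} {m : ℕ} {t : ℕ → ℕ} {b : ℕ → V}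

theorem Base.hub (B : Base G H₀ home l R ex md) (v : V) : Wi H₀ (home v) v R :=
  B.tree v v (B.self v)

theorem Base.hub_dist (B : Base G H₀ home l R ex md) (v : V) : G.dist (home v) v ≤ R :=
  ((B.hub v).mono B.le).dist_le

theorem Base.step (B : Base G H₀ home l R ex md) (h : IsRoute G home l u v m t b) {i : ℕ}
    (hi : i < m) : Wi H₀ (b i) (b (i + 1)) (2 * R) :=
  ((B.hub (b i)).symm.trans (B.tree _ _ (h.stp i hi))).le (by omega)

theorem Base.step_dist (B : Base G H₀ home l R ex md) (h : IsRoute G home l u v m t b) {i : ℕ}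
    (hi : i < m) : G.dist (b i) (b (i + 1)) ≤ 2 * R :=
  ((B.step h hi).mono B.le).dist_le

theorem Base.step_err (B : Base G H₀ home l R ex md) (h : IsRoute G home l u v m t b) {i : ℕ}
    (hi : i < m) (hb : ex (home (b i)) ∨ md (home (b i))) :
    Wi H₀ (b i) (b (i + 1)) (G.dist (b i) (b (i + 1)) + ste R m (fun q => md (home (b q))) i) := by
  classical
  unfold ste
  by_cases h0 : i = 0
  · refine (B.step h hi).le ?_
    rw [if_pos h0]; omega
  by_cases h1 : i + 1 = m
  · refine (B.step h hi).le ?_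
    rw [if_pos h1]; omega
  have hg := h.gen i (by omega)
  have hp := h.gen (i - 1) (by omega)
  rw [show i - 1 + 1 = i by omega] at hp
  by_cases hm : md (home (b i))
  · refine (B.mid _ _ _ hm hp hg).le ?_
    rw [if_pos hm]; omega
  · exact (B.exa _ _ _ (hb.resolve_right hm) hp hg).le (by omega)

open Classical in
theorem IsRoute.chain (h : IsRoute G home l u v m t b) (H : SimpleGraph V) (M : ℕ → Prop) {i j T : ℕ}
    (hij : i ≤ j) (hj : j ≤ m)
    (hs : ∀ q, i ≤ q → q < j → Wi H (b q) (b (q + 1)) (G.dist (b q) (b (q + 1)) + ste R m M q))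
    (hT : ((Finset.Ico i j).filter M).card ≤ T) :
    Wi H (b i) (b j) (G.dist (b i) (b j) + 4 * R + 12 * T) := by
  have key : ∀ j, i ≤ j → j ≤ m →
      (∀ q, i ≤ q → q < j → Wi H (b q) (b (q + 1)) (G.dist (b q) (b (q + 1)) + ste R m M q)) →
      Wi H (b i) (b j) (G.dist (b i) (b j) + ∑ q ∈ Finset.Ico i j, ste R m M q) := by
    intro j hij
    induction j, hij using Nat.le_induction with
    | base => intro _ _; exact (Wi.refl _ _).le (by omega)
    | succ j hij ih =>
      intro hj hs
      have h1 := ih (by omega) fun q a b => hs q a (by omega)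
      have h2 := hs j hij (by omega)
      rw [Finset.sum_Ico_succ_top hij]
      refine (h1.trans h2).le ?_
      have := h.split hij (Nat.le_succ j) hj
      simp only [Nat.succ_eq_add_one] at this
      omega
  refine (key j hij hj hs).le ?_
  have hsum : ∑ q ∈ Finset.Ico i j, ste R m M q ≤ 2 * R + 2 * R + 12 * T := by
    unfold ste
    rw [Finset.sum_add_distrib, Finset.sum_add_distrib]
    gcongr
    · rw [Finset.sum_ite_eq']
      split_ifs <;> omega
    · have : ∀ q, (if q + 1 = m then 2 * R else 0) ≤ (if q = m - 1 then 2 * R else 0) := by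
        intro q
        split_ifs <;> omega
      refine (Finset.sum_le_sum fun q _ => this q).trans ?_
      rw [Finset.sum_ite_eq']
      split_ifs <;> omega
    · rw [← Finset.sum_filter, Finset.sum_const, smul_eq_mul, mul_comm]
      exact Nat.mul_le_mul_left 12 hT
  omega

end


section
variable {V : Type*} [Fintype V] {G H₀ : SimpleGraph V} {home : V → V} {l : V → ℕ} {R : ℕ}
    {ex md : V → Prop}

open Finset in
open Classical in
theorem Base.purchase {u v : V} {m : ℕ} {t : ℕ → ℕ} {b : ℕ → V} (B : Base G H₀ home l R ex md)
    (h : IsRoute G home l u v m t b)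
    (J : Finset ℕ) (hJ : ∀ q ∈ J, q < m) :
    ∃ X ≤ G, X.edgeSet.ncard ≤ 2 * R * #(J.image fun q => home (b q)) ∧
      ∀ q ∈ J, Wi X (b q) (b (q + 1)) (G.dist (b q) (b (q + 1))) := by
  choose Y hY1 hY2 hY3 using fun q => (Wi.of_dist B.conn (b q) (b (q + 1))).exists_sub
  refine ⟨J.sup Y, Finset.sup_le fun q _ => hY1 q, ?_, fun q hq => (hY3 q).mono (Finset.le_sup hq)⟩
  rw [card_image_of_injOn (fun a ha c hc e => h.injOn (hJ a ha) (hJ c hc) e)]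
  calc _ ≤ ∑ q ∈ J, (Y q).edgeSet.ncard := ncard_fsup_le _ _
    _ ≤ ∑ q ∈ J, 2 * R := sum_le_sum fun q hq => (hY2 q).trans (B.step_dist h (hJ q hq))
    _ = _ := by rw [sum_const, smul_eq_mul, mul_comm]

open Finset in
open Classical in
theorem Base.stage1 (B : Base G H₀ home l R ex md) {m : V → V → ℕ} {t : V → V → ℕ → ℕ}
    {b : V → V → ℕ → V} (h : ∀ u v, IsRoute G home l u v (m u v) (t u v) (b u v))
    (S W : Finset V) (hW : ∀ v, ¬ ex (home v) → home v ∈ W) :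
    ∃ H, H₀ ≤ H ∧ H ≤ G ∧ H.edgeSet.ncard ≤ H₀.edgeSet.ncard + 2 * R * (#S * #W) ∧
      ∀ s ∈ S, ∀ s' ∈ S, Wi H s s' (G.dist s s' + 18 * R) := by
  set J : V × V → Finset ℕ := fun p =>
    {q ∈ range (m p.1 p.2) | ¬ ex (home (b p.1 p.2 q))} with hJ
  choose X hX1 hX2 hX3 using fun p : V × V => B.purchase (h p.1 p.2) (J p)
    (fun q hq => by simp only [hJ, mem_filter, mem_range] at hq; exact hq.1)
  have main : ∀ p : V × V, ∀ i j, i ≤ j → j ≤ m p.1 p.2 →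
      Wi (H₀ ⊔ X p) (b p.1 p.2 i) (b p.1 p.2 j)
        (G.dist (b p.1 p.2 i) (b p.1 p.2 j) + 4 * R + 12 * 0) := by
    intro p i j hij hj
    refine (h p.1 p.2).chain (H₀ ⊔ X p) (fun _ => False) hij hj ?_ (by simp)
    intro q hq1 hq2
    by_cases he : ex (home (b p.1 p.2 q))
    · have hlt : q < m p.1 p.2 := by omega
      by_cases h0 : q = 0
      · refine ((B.step (h p.1 p.2) hlt).mono le_sup_left).le ?_
        unfold ste
        rw [if_pos h0]; omega
      by_cases h1 : q + 1 = m p.1 p.2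
      · refine ((B.step (h p.1 p.2) hlt).mono le_sup_left).le ?_
        unfold ste
        rw [if_pos h1]; omega
      have hg := (h p.1 p.2).gen q (by omega)
      have hp := (h p.1 p.2).gen (q - 1) (by omega)
      rw [show q - 1 + 1 = q by omega] at hp
      exact ((B.exa _ _ _ he hp hg).mono le_sup_left).le (by omega)
    · refine ((hX3 p q ?_).mono le_sup_right).le (by omega)
      simp only [hJ, mem_filter, mem_range]
      exact ⟨by omega, he⟩
  have hP := path_buy G H₀ B.le S W (S ×ˢ S) (fun p hp => mem_product.1 hp) X
    (fun p => (J p).image fun q => home (b p.1 p.2 q)) (2 * R) (6 * R) ?_ ?_ ?_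
  · obtain ⟨H, h1, h2, h3, h4⟩ := hP
    refine ⟨H, h1, h2, h3, fun s hs s' hs' => ?_⟩
    exact (h4 (s, s') (mem_product.2 ⟨hs, hs'⟩)).le (by simp only; omega)
  · intro p _
    refine ⟨hX1 p, hX2 p, ?_⟩
    intro c hc
    simp only [mem_image, hJ, mem_filter] at hc
    obtain ⟨q, ⟨_, hq⟩, rfl⟩ := hc
    exact hW _ hq
  · intro p _ c hc
    simp only [mem_image, hJ, mem_filter, mem_range] at hc
    obtain ⟨q, ⟨hqm, _⟩, rfl⟩ := hc
    have w1 := main p 0 q (by omega) hqm.le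
    have w2 := main p q _ hqm.le le_rfl
    have hs := (h p.1 p.2).split (i := 0) (Nat.zero_le q) hqm.le le_rfl
    rw [(h p.1 p.2).b0] at w1 hs
    rw [(h p.1 p.2).bm] at w2 hs
    have hb := (B.hub (b p.1 p.2 q)).mono (le_sup_left : H₀ ≤ H₀ ⊔ X p)
    have hd := B.hub_dist (b p.1 p.2 q)
    set y := b p.1 p.2 q
    have t1 := B.conn.dist_triangle (u := p.1) (v := home y) (w := y)
    have t2 := B.conn.dist_triangle (u := y) (v := home y) (w := p.2)
    have t3 := B.conn.dist_triangle (u := p.1) (v := y) (w := home y)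
    have t4 := B.conn.dist_triangle (u := home y) (v := y) (w := p.2)
    have e := SimpleGraph.dist_comm (G := G) (u := home y) (v := y)
    refine ⟨(w1.trans hb.symm).le (by omega), (hb.trans w2).le (by omega), by omega⟩
  · intro p _
    have w := main p 0 _ (Nat.zero_le _) le_rfl
    rw [(h p.1 p.2).b0, (h p.1 p.2).bm] at w
    exact w.le (by omega)

open Finset in
open Classical in
theorem Base.stage2 (B : Base G H₀ home l R ex md) {m : V → V → ℕ} {t : V → V → ℕ → ℕ}
    {b : V → V → ℕ → V} (h : ∀ u v, IsRoute G home l u v (m u v) (t u v) (b u v))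
    (W : Finset V) (hW : ∀ v, ¬ ex (home v) → ¬ md (home v) → home v ∈ W) (T : ℕ) (hT : T ≤ R) :
    ∃ H, H₀ ≤ H ∧ H ≤ G ∧ H.edgeSet.ncard ≤ H₀.edgeSet.ncard + 2 * R * (#W * #W) ∧
      ∀ u v i j, i ≤ j → j < m u v → home (b u v i) ∈ W → home (b u v j) ∈ W →
        #{q ∈ Ico i j | md (home (b u v q))} ≤ T →
        Wi H (b u v i) (b u v j) (G.dist (b u v i) (b u v j) + 70 * R) := by
  set Q : V × V → V × V × ℕ × ℕ → Prop := fun p w =>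
    w.2.2.1 ≤ w.2.2.2 ∧ w.2.2.2 < m w.1 w.2.1 ∧ home (b w.1 w.2.1 w.2.2.1) = p.1 ∧
    home (b w.1 w.2.1 w.2.2.2) = p.2 ∧ p.1 ∈ W ∧ p.2 ∈ W ∧
    #{q ∈ Ico w.2.2.1 w.2.2.2 | md (home (b w.1 w.2.1 q))} ≤ T with hQ
  have hwit : ∀ p : V × V, ∃ w, (∃ w', Q p w') → Q p w := by
    intro p
    by_cases hp : ∃ w', Q p w'
    · exact ⟨hp.choose, fun _ => hp.choose_spec⟩
    · have : Nonempty V := ⟨p.1⟩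
      exact ⟨(p.1, p.1, 0, 0), fun hh => absurd hh hp⟩
  choose wt hwt using hwit
  set Pr : Finset (V × V) := {p | ∃ w', Q p w'} with hPr
  set J : V × V → Finset ℕ := fun p =>
    {q ∈ range (m (wt p).1 (wt p).2.1) | home (b (wt p).1 (wt p).2.1 q) ∈ W ∧
      (wt p).2.2.1 ≤ q ∧ q ≤ (wt p).2.2.2} with hJ
  choose X hX1 hX2 hX3 using fun p : V × V => B.purchase (h (wt p).1 (wt p).2.1) (J p)
    (fun q hq => by simp only [hJ, mem_filter, mem_range] at hq; exact hq.1)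
  have main : ∀ p ∈ Pr, ∀ i j, (wt p).2.2.1 ≤ i → i ≤ j → j ≤ (wt p).2.2.2 →
      Wi (H₀ ⊔ X p) (home (b (wt p).1 (wt p).2.1 i)) (home (b (wt p).1 (wt p).2.1 j))
        (G.dist (home (b (wt p).1 (wt p).2.1 i)) (home (b (wt p).1 (wt p).2.1 j)) + 20 * R) ∧
      G.dist (home (b (wt p).1 (wt p).2.1 i)) (home (b (wt p).1 (wt p).2.1 j)) ≤
        G.dist (b (wt p).1 (wt p).2.1 i) (b (wt p).1 (wt p).2.1 j) + 2 * R ∧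
      G.dist (b (wt p).1 (wt p).2.1 i) (b (wt p).1 (wt p).2.1 j) ≤
        G.dist (home (b (wt p).1 (wt p).2.1 i)) (home (b (wt p).1 (wt p).2.1 j)) + 2 * R := by
    intro p hp i j hi hij hj
    simp only [hPr, mem_filter, mem_univ, true_and] at hp
    obtain ⟨q1, q2, q3, q4, q5, q6, q7⟩ := hwt p hp
    set rt := h (wt p).1 (wt p).2.1
    have hstep := rt.chain (R := R) (H₀ ⊔ X p)
      (fun q => md (home (b (wt p).1 (wt p).2.1 q))) hij (by omega) (T := T) ?_ ?_
    · have d1 := B.hub_dist (b (wt p).1 (wt p).2.1 i)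
      have d2 := B.hub_dist (b (wt p).1 (wt p).2.1 j)
      have b1 := (B.hub (b (wt p).1 (wt p).2.1 i)).mono (le_sup_left : H₀ ≤ H₀ ⊔ X p)
      have b2 := (B.hub (b (wt p).1 (wt p).2.1 j)).mono (le_sup_left : H₀ ≤ H₀ ⊔ X p)
      set y := b (wt p).1 (wt p).2.1 i
      set z := b (wt p).1 (wt p).2.1 j
      have t1 := B.conn.dist_triangle (u := y) (v := home y) (w := z)
      have t2 := B.conn.dist_triangle (u := home y) (v := home z) (w := z)
      have t3 := B.conn.dist_triangle (u := home y) (v := y) (w := home z)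
      have t4 := B.conn.dist_triangle (u := y) (v := z) (w := home z)
      have e := SimpleGraph.dist_comm (G := G) (u := home y) (v := y)
      have e' := SimpleGraph.dist_comm (G := G) (u := home z) (v := z)
      exact ⟨((b1.trans hstep).trans b2.symm).le (by omega), by omega, by omega⟩
    · intro q hq1 hq2
      by_cases hb : home (b (wt p).1 (wt p).2.1 q) ∈ W
      · refine ((hX3 p q ?_).mono le_sup_right).le (by omega)
        simp only [hJ, mem_filter, mem_range]
        exact ⟨by omega, hb, by omega, by omega⟩
      · refine (B.step_err rt (by omega) ?_).mono le_sup_left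
        by_contra! hcon
        exact hb (hW _ hcon.1 hcon.2)
    · refine le_trans (card_le_card ?_) q7
      intro q hq
      simp only [mem_filter, mem_Ico] at hq ⊢
      exact ⟨⟨by omega, by omega⟩, hq.2⟩
  have hP := path_buy G H₀ B.le W W Pr ?_ X
    (fun p => (J p).image fun q => home (b (wt p).1 (wt p).2.1 q)) (2 * R) (20 * R) ?_ ?_ ?_
  · obtain ⟨H, h1, h2, h3, h4⟩ := hP
    refine ⟨H, h1, h2, h3, fun u v i j hij hj hi' hj' hc => ?_⟩
    have w := h4 (home (b u v i), home (b u v j)) (by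
      simp only [hPr, mem_filter, mem_univ, true_and]
      exact ⟨(u, v, i, j), hij, hj, rfl, rfl, hi', hj', hc⟩)
    simp only at w
    have d1 := B.hub_dist (b u v i)
    have d2 := B.hub_dist (b u v j)
    have b1 := (B.hub (b u v i)).mono h1
    have b2 := (B.hub (b u v j)).mono h1
    set y := b u v i
    set z := b u v j
    have t3 := B.conn.dist_triangle (u := home y) (v := y) (w := home z)
    have t4 := B.conn.dist_triangle (u := y) (v := z) (w := home z)
    have e' := SimpleGraph.dist_comm (G := G) (u := home z) (v := z)
    exact ((b1.symm.trans w).trans b2).le (by omega)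
  · intro p hp
    simp only [hPr, mem_filter, mem_univ, true_and] at hp
    obtain ⟨q1, q2, q3, q4, q5, q6, q7⟩ := hwt p hp
    exact ⟨q5, q6⟩
  · intro p _
    refine ⟨hX1 p, hX2 p, ?_⟩
    intro c hc
    simp only [mem_image, hJ, mem_filter] at hc
    obtain ⟨q, ⟨_, hq⟩, rfl⟩ := hc
    exact hq.1
  · intro p hp c hc
    have hp' := hp
    simp only [hPr, mem_filter, mem_univ, true_and] at hp'
    obtain ⟨q1, q2, q3, q4, q5, q6, q7⟩ := hwt p hp'
    simp only [mem_image, hJ, mem_filter, mem_range] at hc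
    obtain ⟨q, ⟨hqm, _, hq1, hq2⟩, rfl⟩ := hc
    obtain ⟨w1, w2, w3⟩ := main p hp _ q le_rfl hq1 hq2
    obtain ⟨v1, v2, v3⟩ := main p hp q _ hq1 hq2 le_rfl
    obtain ⟨z1, z2, z3⟩ := main p hp _ _ le_rfl q1 le_rfl
    have hs := (h (wt p).1 (wt p).2.1).split hq1 hq2 q2.le
    rw [q3] at w1 w2 w3 z1 z2 z3
    rw [q4] at v1 v2 v3 z1 z2 z3
    exact ⟨w1, v1, by omega⟩
  · intro p hp
    have hp' := hp
    simp only [hPr, mem_filter, mem_univ, true_and] at hp'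
    obtain ⟨q1, q2, q3, q4, q5, q6, q7⟩ := hwt p hp'
    obtain ⟨z1, z2, z3⟩ := main p hp _ _ le_rfl q1 le_rfl
    rw [q3, q4] at z1
    exact z1

end


section
variable {V : Type*} [Fintype V] {G H₀ : SimpleGraph V} {home : V → V} {l : V → ℕ} {R : ℕ}
    {ex md : V → Prop}

open Finset in
open Classical in
theorem Base.seg (B : Base G H₀ home l R ex md) {u v : V} {m : ℕ} {t : ℕ → ℕ}
    {b : ℕ → V} (h : IsRoute G home l u v m t b)
    (W : Finset V) (hW : ∀ v, ¬ ex (home v) → ¬ md (home v) → home v ∈ W) (T : ℕ) (hT : T ≤ R)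
    (H : SimpleGraph V) (hH : H₀ ≤ H)
    (hs : ∀ i j, i ≤ j → j < m → home (b i) ∈ W → home (b j) ∈ W →
        #{q ∈ Ico i j | md (home (b q))} ≤ T →
        Wi H (b i) (b j) (G.dist (b i) (b j) + 70 * R)) (i j : ℕ) (hij : i ≤ j) (hj : j ≤ m)
    (hc : #{q ∈ Ico i j | md (home (b q))} ≤ T) :
    Wi H (b i) (b j) (G.dist (b i) (b j) + 104 * R) := by
  have sub : ∀ i' j', i ≤ i' → j' ≤ j → #{q ∈ Ico i' j' | md (home (b q))} ≤ T := by
    intro i' j' hi' hj'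
    refine le_trans (card_le_card ?_) hc
    intro q hq
    simp only [mem_filter, mem_Ico] at hq ⊢
    exact ⟨⟨by omega, by omega⟩, hq.2⟩
  have nobig : ∀ i' j', i ≤ i' → i' ≤ j' → j' ≤ j →
      (∀ q, i' ≤ q → q < j' → home (b q) ∉ W) →
      Wi H (b i') (b j') (G.dist (b i') (b j') + 16 * R) := by
    intro i' j' hi' hij' hj' hn
    have := h.chain (R := R) H (fun q => md (home (b q))) hij' (by omega) (T := T) ?_
      (sub i' j' hi' hj')
    · exact this.le (by omega)
    · intro q hq1 hq2
      refine (B.step_err h (by omega) ?_).mono hH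
      by_contra! hcon
      exact hn q hq1 hq2 (hW _ hcon.1 hcon.2)
  set F : Finset ℕ := {q ∈ Ico i j | home (b q) ∈ W} with hF
  rcases F.eq_empty_or_nonempty with h0 | hne
  · refine (nobig i j le_rfl hij le_rfl ?_).le (by omega)
    intro q hq1 hq2 hq
    have : q ∈ F := by simp only [hF, mem_filter, mem_Ico]; exact ⟨⟨hq1, hq2⟩, hq⟩
    rw [h0] at this
    simp at this
  · obtain ⟨p, m1, l1⟩ : ∃ p ∈ F, ∀ s ∈ F, p ≤ s := ⟨_, F.min'_mem hne, F.min'_le⟩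
    obtain ⟨q, m2, l2⟩ : ∃ q ∈ F, ∀ s ∈ F, s ≤ q := ⟨_, F.max'_mem hne, F.le_max'⟩
    have hpq : p ≤ q := l1 q m2
    simp only [hF, mem_filter, mem_Ico] at m1 m2 l1 l2
    have w1 := nobig i p le_rfl m1.1.1 (by omega) (fun s hs1 hs2 hs3 => by
      have := l1 s ⟨⟨hs1, by omega⟩, hs3⟩; omega)
    have w2 := hs p q hpq (by omega) m1.2 m2.2 (sub p q m1.1.1 (by omega))
    have w3 := (B.step h (i := q) (by omega)).mono hH
    have w4 := nobig (q + 1) j (by omega) (by omega) le_rfl (fun s hs1 hs2 hs3 => by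
      have := l2 s ⟨⟨by omega, by omega⟩, hs3⟩; omega)
    have s1 := h.split m1.1.1 hpq (by omega)
    have s2 := h.split m2.1.1 (Nat.le_succ q) (by omega)
    have s3 := h.split (i := i) (j := q + 1) (by omega) m2.1.2 hj
    simp only [Nat.succ_eq_add_one] at s2 s3
    exact (((w1.trans w2).trans w3).trans w4).le (by omega)

open Finset in
open Classical in
theorem Base.combine (B : Base G H₀ home l R ex md) {m : V → V → ℕ} {t : V → V → ℕ → ℕ}
    {b : V → V → ℕ → V} (h : ∀ u v, IsRoute G home l u v (m u v) (t u v) (b u v))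
    (S W W₂ : Finset V) (hW : ∀ v, ¬ ex (home v) → home v ∈ W)
    (hW₂ : ∀ v, ¬ ex (home v) → ¬ md (home v) → home v ∈ W₂) (T : ℕ) (hT : T ≤ R)
    (hS1 : ∀ u v, T ≤ #{q ∈ range (m u v) | md (home (b u v q))} →
      ∃ i < m u v, home (b u v i) ∈ S ∧
        #{q ∈ {q ∈ range (m u v) | md (home (b u v q))} | q < i} < T)
    (hS2 : ∀ u v, T ≤ #{q ∈ range (m u v) | md (home (b u v q))} →
      ∃ i < m u v, home (b u v i) ∈ S ∧
        #{q ∈ {q ∈ range (m u v) | md (home (b u v q))} | i < q} < T) :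
    ∃ H ≤ G, H.edgeSet.ncard ≤ 2 * H₀.edgeSet.ncard + 2 * R * (#S * #W) + 2 * R * (#W₂ * #W₂) ∧
      ∀ u v, Wi H u v (G.dist u v + 230 * R) := by
  obtain ⟨H1, a1, a2, a3, a4⟩ := B.stage1 h S W hW
  obtain ⟨H2, c1, c2, c3, c4⟩ := B.stage2 h W₂ hW₂ T hT
  refine ⟨H1 ⊔ H2, sup_le a2 c2, ?_, ?_⟩
  · have := ncard_sup_le H1 H2
    omega
  intro u v
  have rt := h u v
  have sg : ∀ i j, i ≤ j → j ≤ m u v → #{q ∈ Ico i j | md (home (b u v q))} ≤ T →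
      Wi (H1 ⊔ H2) (b u v i) (b u v j) (G.dist (b u v i) (b u v j) + 104 * R) := by
    intro i j hij hj hc
    exact (B.seg rt W₂ hW₂ T hT H2 c1 (fun i j => c4 u v i j) i j hij hj hc).mono le_sup_right
  by_cases hmm : T ≤ #{q ∈ range (m u v) | md (home (b u v q))}
  · obtain ⟨i, hi1, hi2, hi3⟩ := hS1 u v hmm
    obtain ⟨j, hj1, hj2, hj3⟩ := hS2 u v hmm
    have : ∃ j, i ≤ j ∧ j < m u v ∧ home (b u v j) ∈ S ∧
        #{q ∈ {q ∈ range (m u v) | md (home (b u v q))} | j < q} < T := by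
      by_cases hij : i ≤ j
      · exact ⟨j, hij, hj1, hj2, hj3⟩
      · refine ⟨i, le_rfl, hi1, hi2, lt_of_le_of_lt (card_le_card ?_) hj3⟩
        intro q hq
        simp only [mem_filter] at hq ⊢
        exact ⟨hq.1, by omega⟩
    obtain ⟨j, hij, hj1, hj2, hj3⟩ := this
    have g1 := sg 0 i (by omega) hi1.le (by
      refine le_trans (card_le_card ?_) hi3.le
      intro q hq
      simp only [mem_filter, mem_Ico, mem_range] at hq ⊢
      exact ⟨⟨by omega, hq.2⟩, by omega⟩)
    have g2 := sg j (m u v) hj1.le le_rfl (by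
      have : #{q ∈ Ico j (m u v) | md (home (b u v q))} ≤
          #(insert j {q ∈ {q ∈ range (m u v) | md (home (b u v q))} | j < q}) := by
        apply card_le_card
        intro q hq
        simp only [mem_filter, mem_Ico, mem_range, mem_insert] at hq ⊢
        by_cases hqj : q = j
        · exact Or.inl hqj
        · exact Or.inr ⟨⟨by omega, hq.2⟩, by omega⟩
      have := card_insert_le j {q ∈ {q ∈ range (m u v) | md (home (b u v q))} | j < q}
      omega)
    have g3 := (a4 _ hi2 _ hj2).mono (le_sup_left : H1 ≤ H1 ⊔ H2)
    have s1 := rt.split (Nat.zero_le i) hij hj1.le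
    have s2 := rt.split (Nat.zero_le j) hj1.le le_rfl
    rw [rt.b0] at g1 s1 s2
    rw [rt.bm] at g2 s2
    have d1 := B.hub_dist (b u v i)
    have d2 := B.hub_dist (b u v j)
    have b1 := (B.hub (b u v i)).mono (a1.trans (le_sup_left : H1 ≤ H1 ⊔ H2))
    have b2 := (B.hub (b u v j)).mono (a1.trans (le_sup_left : H1 ≤ H1 ⊔ H2))
    set y := b u v i
    set z := b u v j
    have t3 := B.conn.dist_triangle (u := home y) (v := y) (w := home z)
    have t4 := B.conn.dist_triangle (u := y) (v := z) (w := home z)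
    have e' := SimpleGraph.dist_comm (G := G) (u := home z) (v := z)
    exact ((((g1.trans b1.symm).trans g3).trans b2).trans g2).le (by omega)
  · have g := sg 0 (m u v) (by omega) le_rfl (by rw [← range_eq_Ico]; omega)
    rw [rt.b0, rt.bm] at g
    exact g.le (by omega)

end

open Finset in
theorem hit_rank {α : Type*} [LinearOrder α] (M : Finset α) (T : ℕ) (hT : T ≤ #M) :
    T ≤ #{i ∈ M | #{q ∈ M | q < i} < T} := by
  have hinj : Set.InjOn (fun i => #{q ∈ M | q < i}) (M : Set α) := by
    have : ∀ a ∈ M, ∀ c, a < c → #{q ∈ M | q < a} < #{q ∈ M | q < c} := by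
      intro a ha c hac
      apply card_lt_card
      rw [ssubset_iff_of_subset]
      · exact ⟨a, by simp [ha, hac], by simp⟩
      · intro q hq
        simp only [mem_filter] at hq ⊢
        exact ⟨hq.1, hq.2.trans hac⟩
    intro a ha c hc e
    simp only at e
    rcases lt_trichotomy a c with h | h | h
    · have := this a ha c h; omega
    · exact h
    · have := this c hc a h; omega
  have himg : M.image (fun i => #{q ∈ M | q < i}) = range #M := by
    apply eq_of_subset_of_card_le
    · intro k hk
      simp only [mem_image] at hk
      obtain ⟨i, hi, rfl⟩ := hk
      rw [mem_range]
      apply card_lt_card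
      rw [ssubset_iff_of_subset (filter_subset _ _)]
      exact ⟨i, hi, by simp⟩
    · rw [card_image_of_injOn hinj, card_range]
  have : range T ⊆ ({i ∈ M | #{q ∈ M | q < i} < T}).image (fun i => #{q ∈ M | q < i}) := by
    intro k hk
    rw [mem_range] at hk
    have h1 : k ∈ M.image (fun i => #{q ∈ M | q < i}) := by rw [himg, mem_range]; omega
    simp only [mem_image] at h1
    obtain ⟨i, hi, rfl⟩ := h1
    simp only [mem_image, mem_filter]
    exact ⟨i, ⟨hi, hk⟩, rfl⟩
  have h2 := card_le_card this
  rw [card_range] at h2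
  exact h2.trans card_image_le

open Finset in
open Classical in
theorem hit_greedy {V ι : Type*} (F : Finset ι) (A : ι → Finset V) (W : Finset V) (T : ℕ)
    (hA : ∀ i ∈ F, A i ⊆ W ∧ T ≤ #(A i)) (hT : 1 ≤ T) (s : ℕ) :
    ∃ S : Finset V, #S ≤ s ∧
      (#{i ∈ F | Disjoint (A i) S} : ℝ) ≤ #F * Real.exp (-(s * (T / #W))) := by
  induction s with
  | zero => exact ⟨∅, by simp⟩
  | succ s ih =>
    obtain ⟨S, hS, hb⟩ := ih
    set F' : Finset ι := {i ∈ F | Disjoint (A i) S} with hF'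
    rcases F'.eq_empty_or_nonempty with h0 | ⟨i0, hi0⟩
    · refine ⟨S, by omega, ?_⟩
      rw [← hF', h0]
      simp only [card_empty, Nat.cast_zero]
      positivity
    have hFF : F' ⊆ F := filter_subset _ _
    have hWpos : 0 < #W := by
      have := hA i0 (hFF hi0)
      have := card_le_card this.1
      omega
    have hdc : ∑ w ∈ W, #{i ∈ F' | w ∈ A i} = ∑ i ∈ F', #(A i) := by
      have := sum_card_bipartiteAbove_eq_sum_card_bipartiteBelow (s := W) (t := F')
        (fun w i => w ∈ A i)
      unfold bipartiteAbove bipartiteBelow at this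
      rw [this]
      refine sum_congr rfl fun i hi => ?_
      congr 1
      ext w
      simp only [mem_filter]
      exact ⟨fun h => h.2, fun h => ⟨(hA i (hFF hi)).1 h, h⟩⟩
    have hge : #F' * T ≤ ∑ w ∈ W, #{i ∈ F' | w ∈ A i} := by
      rw [hdc, ← smul_eq_mul, ← sum_const]
      exact sum_le_sum fun i hi => (hA i (hFF hi)).2
    obtain ⟨w, hw, hwc⟩ : ∃ w ∈ W, #F' * T ≤ #W * #{i ∈ F' | w ∈ A i} := by
      by_contra! hcon
      have h1 : ∑ w ∈ W, #W * #{i ∈ F' | w ∈ A i} < ∑ w ∈ W, #F' * T :=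
        sum_lt_sum_of_nonempty (card_pos.1 hWpos) hcon
      rw [← mul_sum, sum_const, smul_eq_mul] at h1
      exact absurd (Nat.lt_of_mul_lt_mul_left h1) (not_lt.2 hge)
    refine ⟨insert w S, (card_insert_le _ _).trans (by omega), ?_⟩
    have hsplit : #{i ∈ F | Disjoint (A i) (insert w S)} + #{i ∈ F' | w ∈ A i} ≤ #F' := by
      rw [← card_union_of_disjoint]
      · apply card_le_card
        intro i hi
        simp only [mem_union, hF', mem_filter, disjoint_insert_right] at hi ⊢
        tauto
      · rw [disjoint_left]
        intro i hi hi'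
        simp only [mem_filter, disjoint_insert_right] at hi hi'
        tauto
    have hWr : (0 : ℝ) < #W := by exact_mod_cast hWpos
    have hwc' : (#F' : ℝ) * (T / #W) ≤ #{i ∈ F' | w ∈ A i} := by
      rw [← mul_div_assoc, div_le_iff₀ hWr]
      have : ((#F' * T : ℕ) : ℝ) ≤ ((#W * #{i ∈ F' | w ∈ A i} : ℕ) : ℝ) := by exact_mod_cast hwc
      push_cast at this
      linarith
    have hsplit' : (#{i ∈ F | Disjoint (A i) (insert w S)} : ℝ) + #{i ∈ F' | w ∈ A i} ≤ #F' := by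
      exact_mod_cast hsplit
    have hexp : 1 - (T / #W : ℝ) ≤ Real.exp (-(T / #W)) := by
      have := Real.add_one_le_exp (-(T / #W : ℝ)); linarith
    calc (#{i ∈ F | Disjoint (A i) (insert w S)} : ℝ) ≤ #F' * (1 - T / #W) := by linarith
      _ ≤ #F' * Real.exp (-(T / #W)) := by gcongr
      _ ≤ (#F * Real.exp (-(s * (T / #W)))) * Real.exp (-(T / #W)) := by gcongr
      _ = _ := by
        rw [mul_assoc, ← Real.exp_add]; push_cast; ring_nf

open Finset in
theorem hit_exists {V ι : Type*} (F : Finset ι) (A : ι → Finset V) (W : Finset V) (T : ℕ)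
    (hA : ∀ i ∈ F, A i ⊆ W ∧ T ≤ #(A i)) (hT : 1 ≤ T) :
    ∃ S : Finset V, (#S : ℝ) ≤ #W / T * Real.log #F + 2 ∧ ∀ i ∈ F, ∃ w ∈ S, w ∈ A i := by
  classical
  rcases F.eq_empty_or_nonempty with rfl | ⟨i0, hi0⟩
  · exact ⟨∅, by simp⟩
  have hWpos : 0 < #W := by
    have := hA i0 hi0
    have := card_le_card this.1
    omega
  have hFpos : 0 < #F := card_pos.2 ⟨i0, hi0⟩
  have hWr : (0 : ℝ) < #W := by exact_mod_cast hWpos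
  have hFr : (0 : ℝ) < #F := by exact_mod_cast hFpos
  have hTr : (0 : ℝ) < T := by exact_mod_cast hT
  have hlog : 0 ≤ Real.log #F := Real.log_nonneg (by exact_mod_cast hFpos)
  set z : ℝ := #W / T * Real.log #F with hz
  have hz0 : 0 ≤ z := by positivity
  obtain ⟨S, hS, hb⟩ := hit_greedy F A W T hA hT (⌊z⌋₊ + 1)
  refine ⟨S, ?_, ?_⟩
  · have h1 : (#S : ℝ) ≤ ((⌊z⌋₊ + 1 : ℕ) : ℝ) := by exact_mod_cast hS
    have h2 := Nat.floor_le hz0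
    push_cast at h1
    linarith
  · have hlt : (#{i ∈ F | Disjoint (A i) S} : ℝ) < 1 := by
      refine lt_of_le_of_lt hb ?_
      have h1 := Nat.lt_floor_add_one z
      have h2 : Real.log #F < ((⌊z⌋₊ + 1 : ℕ) : ℝ) * (T / #W) := by
        have : Real.log #F = z * (T / #W) := by rw [hz]; field_simp
        rw [this]
        have h3 : ((⌊z⌋₊ + 1 : ℕ) : ℝ) = (⌊z⌋₊ : ℝ) + 1 := by rw [Nat.cast_add, Nat.cast_one]
        rw [h3]
        exact mul_lt_mul_of_pos_right h1 (div_pos hTr hWr)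
      calc (#F : ℝ) * Real.exp (-(((⌊z⌋₊ + 1 : ℕ) : ℝ) * (T / #W)))
          < #F * Real.exp (-(Real.log #F)) := by gcongr
        _ = 1 := by rw [Real.exp_neg, Real.exp_log hFr]; field_simp
    have h0 : #{i ∈ F | Disjoint (A i) S} = 0 := by
      have : #{i ∈ F | Disjoint (A i) S} < 1 := by exact_mod_cast hlt
      omega
    intro i hi
    by_contra! hcon
    rw [card_eq_zero] at h0
    have : i ∈ ({i ∈ F | Disjoint (A i) S} : Finset ι) := by
      simp only [mem_filter]
      exact ⟨hi, disjoint_left.2 fun w hw hw' => hcon w hw' hw⟩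
    rw [h0] at this
    simp at this


theorem arith_exact (σ β Λ r D : ℝ) (hσ : 0 < σ) (hβ : 0 ≤ β) (hΛ : 0 ≤ Λ) (hr : 1 ≤ r)
    (hD : 0 ≤ D) (h1 : σ ≤ D * r ^ (6 / 5 : ℝ)) (h2 : Λ * r ≤ σ) :
    σ ^ (4 / 5 : ℝ) * (β * Λ) ^ (3 / 5 : ℝ) ≤ D * (σ + r * β) := by
  have hr0 : 0 < r := by linarith
  set y := r * β with hy
  have hy0 : 0 ≤ y := by positivity
  have hp : β * Λ ≤ y * σ / r ^ (2 : ℝ) := by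
    rw [le_div_iff₀ (by positivity), Real.rpow_two, hy]
    nlinarith [mul_nonneg hβ hr0.le]
  have e1 : (y * σ / r ^ (2 : ℝ)) ^ (3 / 5 : ℝ) =
      y ^ (3 / 5 : ℝ) * σ ^ (3 / 5 : ℝ) / r ^ (6 / 5 : ℝ) := by
    rw [Real.div_rpow (by positivity) (by positivity), Real.mul_rpow hy0 hσ.le,
      ← Real.rpow_mul hr0.le]
    norm_num
  have e2 : σ ^ (4 / 5 : ℝ) * σ ^ (3 / 5 : ℝ) = σ * σ ^ (2 / 5 : ℝ) := by
    rw [← Real.rpow_add hσ]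
    nth_rewrite 2 [← Real.rpow_one σ]
    rw [← Real.rpow_add hσ]
    norm_num
  have e3 : σ ^ (2 / 5 : ℝ) * y ^ (3 / 5 : ℝ) ≤ σ + y := by
    have := Real.geom_mean_le_arith_mean2_weighted (w₁ := 2 / 5) (w₂ := 3 / 5) (by norm_num)
      (by norm_num) hσ.le hy0 (by norm_num)
    linarith
  calc σ ^ (4 / 5 : ℝ) * (β * Λ) ^ (3 / 5 : ℝ)
      ≤ σ ^ (4 / 5 : ℝ) * (y * σ / r ^ (2 : ℝ)) ^ (3 / 5 : ℝ) := by gcongr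
    _ = (σ ^ (4 / 5 : ℝ) * σ ^ (3 / 5 : ℝ)) * y ^ (3 / 5 : ℝ) / r ^ (6 / 5 : ℝ) := by
        rw [e1]; ring
    _ = (σ / r ^ (6 / 5 : ℝ)) * (σ ^ (2 / 5 : ℝ) * y ^ (3 / 5 : ℝ)) := by rw [e2]; ring
    _ ≤ D * (σ + y) := by
        gcongr
        rw [div_le_iff₀ (by positivity)]
        exact h1

theorem arith_mid (σ β Λ r D : ℝ) (hσ : 0 ≤ σ) (hβ : 0 ≤ β) (hΛ : 0 ≤ Λ) (hr : 1 ≤ r)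
    (hD : 1 ≤ D) (h1 : σ ≤ D ^ 2 * r) (h2 : Λ * r ≤ σ) :
    σ * (Real.sqrt (β + Λ) + 1) ≤ 3 * (D * (σ + r * β)) := by
  have hr0 : 0 < r := by linarith
  have a1 : Real.sqrt (β + Λ) ≤ Real.sqrt β + Real.sqrt Λ := by
    rw [Real.sqrt_le_iff]
    refine ⟨by positivity, ?_⟩
    have := mul_nonneg (Real.sqrt_nonneg β) (Real.sqrt_nonneg Λ)
    rw [add_sq, Real.sq_sqrt hβ, Real.sq_sqrt hΛ]
    linarith
  have hΛD : Λ ≤ D ^ 2 := by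
    have : Λ * r ≤ D ^ 2 * r := h2.trans h1
    exact le_of_mul_le_mul_right this hr0
  have a2 : Real.sqrt Λ ≤ D := Real.sqrt_le_iff.2 ⟨by linarith, hΛD⟩
  have a3 : σ * Real.sqrt β ≤ D * (σ + r * β) := by
    have b1 : Real.sqrt σ ≤ D * Real.sqrt r := by
      rw [Real.sqrt_le_iff]
      refine ⟨by positivity, ?_⟩
      rw [mul_pow, Real.sq_sqrt hr0.le]
      exact h1
    have b2 := Real.sq_sqrt hσ
    have b3 := Real.sq_sqrt hβ
    have b4 := Real.sq_sqrt hr0.le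
    set s := Real.sqrt σ
    set q := Real.sqrt β
    set w := Real.sqrt r
    have hs : 0 ≤ s := Real.sqrt_nonneg _
    have hq : 0 ≤ q := Real.sqrt_nonneg _
    have hw : 0 ≤ w := Real.sqrt_nonneg _
    have c1 : s * (w * q) ≤ σ + r * β := by
      rw [← b2, ← b3, ← b4]
      nlinarith [sq_nonneg (s - w * q), sq_nonneg (s), sq_nonneg (w * q)]
    calc σ * q = s * (s * q) := by rw [← b2]; ring
      _ ≤ (D * w) * (s * q) := by gcongr
      _ = D * (s * (w * q)) := by ring
      _ ≤ _ := by gcongr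
  have a4 : σ ≤ D * (σ + r * β) := by
    have : 0 ≤ r * β := by positivity
    nlinarith
  have a5 : σ * Real.sqrt Λ ≤ D * (σ + r * β) := by
    have : 0 ≤ D * (r * β) := by positivity
    nlinarith
  nlinarith [mul_le_mul_of_nonneg_left a1 hσ]

open Finset in
theorem cell_exists {V : Type*} [Fintype V] {G : SimpleGraph V} (hG : G.Connected) (c : V) (y : ℕ)
    (β Λ : Finset V) (hβ : ∀ a ∈ β, G.dist c a ≤ y) (hΛ : ∀ a ∈ Λ, G.dist c a ≤ y) (r : ℕ)
    (hr : 1 ≤ r) (D : ℝ) (hD : 1 ≤ D) (hc : #Λ * r ≤ #(gball G c (2 * y))) :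
    ∃ X ≤ G, (∀ a, G.dist c a ≤ y → Wi X c a (G.dist c a)) ∧
      ((#(gball G c (2 * y)) : ℝ) ≤ D * (r : ℝ) ^ (6 / 5 : ℝ) →
        ∀ a ∈ β, ∀ w ∈ Λ, Wi X a w (G.dist a w)) ∧
      ((#(gball G c (2 * y)) : ℝ) ≤ D ^ 2 * r →
        ∀ a ∈ β, ∀ w ∈ Λ, Wi X a w (G.dist a w + 12)) ∧
      (X.edgeSet.ncard : ℝ) ≤ 229 * (D * (#(gball G c (2 * y)) + r * #β)) := by
  classical
  set σ := #(gball G c (2 * y)) with hσ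
  have hσ1 : 1 ≤ σ := card_pos.2 ⟨c, by rw [mem_gball]; simp⟩
  have hrr : (1 : ℝ) ≤ r := by exact_mod_cast hr
  have hσr : (1 : ℝ) ≤ σ := by exact_mod_cast hσ1
  have hc' : (#Λ : ℝ) * r ≤ σ := by exact_mod_cast hc
  have hσD : (σ : ℝ) ≤ D * (σ + r * #β) := by
    have : 0 ≤ (r : ℝ) * #β := by positivity
    nlinarith
  have hβ0 : (0 : ℝ) ≤ #β := by positivity
  have hΛ0 : (0 : ℝ) ≤ #Λ := by positivity
  obtain ⟨X1, a1, a2, a3⟩ := ball_tree hG c y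
  have a3' : (X1.edgeSet.ncard : ℝ) ≤ σ := by
    have := a3.trans (card_le_card (gball_mono (G := G) (c := c) (show y ≤ 2 * y by omega)))
    exact_mod_cast this
  obtain ⟨X2, b1, b2, b3⟩ : ∃ X ≤ G, ((σ : ℝ) ≤ D * (r : ℝ) ^ (6 / 5 : ℝ) →
        ∀ a ∈ β, ∀ w ∈ Λ, Wi X a w (G.dist a w)) ∧
        (X.edgeSet.ncard : ℝ) ≤ 204 * (D * (σ + r * #β)) := by
    by_cases h : (σ : ℝ) ≤ D * (r : ℝ) ^ (6 / 5 : ℝ)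
    · obtain ⟨X, c1, c2, c3⟩ := arena_preserver hG c y (β ×ˢ Λ)
        (fun p hp => ⟨hβ _ (mem_product.1 hp).1, hΛ _ (mem_product.1 hp).2⟩)
      refine ⟨X, c1, fun _ a ha w hw => c2 (a, w) (mem_product.2 ⟨ha, hw⟩), c3.trans ?_⟩
      rw [card_product, ← hσ]
      push_cast
      have h1 := arith_exact σ #β #Λ r D (by linarith) hβ0 hΛ0 hrr (by linarith) h hc'
      have h2 : (#β : ℝ) * #Λ ≤ D * (σ + r * #β) := by
        have e1 : (#Λ : ℝ) * r ≤ D * r * r := by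
          refine hc'.trans (h.trans ?_)
          rw [mul_assoc]
          have : (r : ℝ) ^ (6 / 5 : ℝ) ≤ r ^ (2 : ℝ) :=
            Real.rpow_le_rpow_of_exponent_le hrr (by norm_num)
          rw [Real.rpow_two, sq] at this
          gcongr
        have e2 : (#Λ : ℝ) ≤ D * r := le_of_mul_le_mul_right e1 (by linarith)
        have e3 : (#β : ℝ) * #Λ ≤ #β * (D * r) := by gcongr
        have e4 : 0 ≤ D * σ := by positivity
        nlinarith
      linarith
    · refine ⟨⊥, bot_le, fun h' => absurd h' h, ?_⟩
      simp only [SimpleGraph.edgeSet_bot, Set.ncard_empty, Nat.cast_zero]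
      positivity
  obtain ⟨X3, d1, d2, d3⟩ : ∃ X ≤ G, ((σ : ℝ) ≤ D ^ 2 * r →
        ∀ a ∈ β, ∀ w ∈ Λ, Wi X a w (G.dist a w + 12)) ∧
        (X.edgeSet.ncard : ℝ) ≤ 24 * (D * (σ + r * #β)) := by
    by_cases h : (σ : ℝ) ≤ D ^ 2 * r
    · obtain ⟨X, c1, c2, c3⟩ := arena_subset hG c y (β ∪ Λ)
        (fun p hp => (mem_union.1 hp).elim (hβ p) (hΛ p)) (Nat.sqrt #(β ∪ Λ) + 1) (by omega)
        (by rw [sq]; exact (Nat.lt_succ_sqrt _).le)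
      refine ⟨X, c1, fun _ a ha w hw => c2 a (mem_union_left _ ha) w (mem_union_right _ hw), ?_⟩
      have h1 := arith_mid σ #β #Λ r D (by linarith) hβ0 hΛ0 hrr hD h hc'
      have h2 : ((Nat.sqrt #(β ∪ Λ) : ℕ) : ℝ) ≤ Real.sqrt (#β + #Λ) := by
        refine Real.nat_sqrt_le_real_sqrt.trans (Real.sqrt_le_sqrt ?_)
        exact_mod_cast card_union_le β Λ
      have h3 : (X.edgeSet.ncard : ℝ) ≤ 8 * σ * ((Nat.sqrt #(β ∪ Λ) : ℕ) + 1) := by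
        exact_mod_cast c3
      have h4 : (σ : ℝ) * ((Nat.sqrt #(β ∪ Λ) : ℕ) + 1) ≤ σ * (Real.sqrt (#β + #Λ) + 1) := by
        gcongr
      linarith
    · refine ⟨⊥, bot_le, fun h' => absurd h' h, ?_⟩
      simp only [SimpleGraph.edgeSet_bot, Set.ncard_empty, Nat.cast_zero]
      positivity
  refine ⟨X1 ⊔ X2 ⊔ X3, sup_le (sup_le a1 b1) d1, fun a ha => (a2 a ha).mono ?_,
    fun h a ha w hw => (b2 h a ha w hw).mono ?_, fun h a ha w hw => (d2 h a ha w hw).mono ?_, ?_⟩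
  · exact le_sup_left.trans le_sup_left
  · exact le_sup_right.trans le_sup_left
  · exact le_sup_right
  · have e1 := ncard_sup_le (X1 ⊔ X2) X3
    have e2 := ncard_sup_le X1 X2
    have e3 : ((X1 ⊔ X2 ⊔ X3).edgeSet.ncard : ℝ) ≤
        X1.edgeSet.ncard + X2.edgeSet.ncard + X3.edgeSet.ncard := by
      exact_mod_cast (by omega : (X1 ⊔ X2 ⊔ X3).edgeSet.ncard ≤
        X1.edgeSet.ncard + X2.edgeSet.ncard + X3.edgeSet.ncard)
    linarith


open Finset in
theorem hit_rank_nat (M : Finset ℕ) (T : ℕ) (hT : T ≤ #M) :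
    T ≤ #{i ∈ M | #{q ∈ M | i < q} < T} := by
  exact hit_rank (α := ℕᵒᵈ) M T hT

open Finset in
theorem card_mul_le_sum {V : Type*} (C : Finset V) (σ : V → ℕ) (s N : ℝ)
    (h : ∑ c ∈ C, (σ c : ℝ) ≤ N) (W : Finset V) (hW : W ⊆ C) (hs : ∀ c ∈ W, s ≤ σ c) :
    (#W : ℝ) * s ≤ N := by
  calc (#W : ℝ) * s = ∑ c ∈ W, s := by rw [sum_const, nsmul_eq_mul]
    _ ≤ ∑ c ∈ W, (σ c : ℝ) := sum_le_sum hs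
    _ ≤ ∑ c ∈ C, (σ c : ℝ) := sum_le_sum_of_subset_of_nonneg hW fun _ _ _ => by positivity
    _ ≤ N := h

open Finset in
theorem main_fin {V : Type*} [Fintype V] {G : SimpleGraph V} (hG : G.Connected) (r k : ℕ)
    (hr : 1 ≤ r) (hk : 1 ≤ k) (D : ℝ) (hD : 1 ≤ D) (N : ℝ)
    (hN : (Fintype.card V : ℝ) ^ (1 / (k : ℝ)) * Fintype.card V = N) :
    ∃ H ≤ G, (∀ u v, Wi H u v (G.dist u v + 690 * (r * 6 ^ k))) ∧
      ∃ w w₂ : ℝ, 0 ≤ w ∧ 0 ≤ w₂ ∧ w * (D * (r : ℝ) ^ (6 / 5 : ℝ)) ≤ N ∧ w₂ * (D ^ 2 * r) ≤ N ∧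
      (H.edgeSet.ncard : ℝ) ≤ 916 * (D * N) +
        6 * (r * 6 ^ k) * ((w / r * Real.log (2 * (Fintype.card V : ℝ) ^ 2) + 2) * w) +
        6 * (r * 6 ^ k) * (w₂ * w₂) := by
  classical
  obtain ⟨C, home, x, l, hh, hc, hsum⟩ := cover_exists hG r k hr hk
  rw [hN] at hsum
  set σ : V → ℕ := fun c => #(gball G c (6 * x c)) with hσ
  set R := 3 * (r * 6 ^ k) with hR
  have hTR : r ≤ R := by
    have : r ≤ r * 6 ^ k := Nat.le_mul_of_pos_right _ (by positivity)
    omega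
  set Bd : Finset V := C.biUnion fun c => gsph G c (l c) with hBd
  set β : V → Finset V := fun c => {b ∈ Bd | home b = c} with hβ
  have hcell : ∀ c, ∃ X ≤ G, (∀ a, G.dist c a ≤ 3 * x c → Wi X c a (G.dist c a)) ∧
      ((σ c : ℝ) ≤ D * (r : ℝ) ^ (6 / 5 : ℝ) →
        ∀ a ∈ β c, ∀ w ∈ gsph G c (l c), Wi X a w (G.dist a w)) ∧
      ((σ c : ℝ) ≤ D ^ 2 * r →
        ∀ a ∈ β c, ∀ w ∈ gsph G c (l c), Wi X a w (G.dist a w + 12)) ∧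
      (X.edgeSet.ncard : ℝ) ≤ 229 * (D * (σ c + r * #(β c))) := by
    intro c
    have := cell_exists hG c (3 * x c) (β c) (gsph G c (l c)) ?_ ?_ r hr D hD ?_
    · rw [show 2 * (3 * x c) = 6 * x c by ring] at this
      exact this
    · intro a ha
      simp only [hβ, mem_filter] at ha
      have := (hh a).2
      rw [ha.2] at this
      omega
    · intro a ha
      rw [mem_gsph] at ha
      have := (hc c).2.2.2.1
      omega
    · rw [show 2 * (3 * x c) = 6 * x c by ring]
      exact (hc c).2.2.2.2
  choose X hX1 hX2 hX3 hX4 hX5 using hcell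
  set ex : V → Prop := fun c => (σ c : ℝ) ≤ D * (r : ℝ) ^ (6 / 5 : ℝ) with hex
  set md : V → Prop := fun c => (σ c : ℝ) ≤ D ^ 2 * r ∧ ¬ ex c with hmd
  have hle : ∀ v, X (home v) ≤ C.sup X := fun v => Finset.le_sup (hh v).1
  have memβ : ∀ u v, G.dist (home u) v = l (home u) → v ∈ β (home v) := by
    intro u v h
    simp only [hβ, hBd, mem_filter, mem_biUnion, mem_gsph, and_true]
    exact ⟨home u, (hh u).1, h⟩
  have base : Base G (C.sup X) home l R ex md :=
    { le := Finset.sup_le fun c _ => hX1 c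
      conn := hG
      self := fun v => by
        have a := (hh v).2
        have b := (hc (home v)).2.2.1
        omega
      tree := fun v w h => by
        have b := (hc (home v)).2.2.2.1
        have b' := (hc (home v)).2.1
        exact ((hX2 (home v) w (by omega)).mono (hle v)).le (by omega)
      exa := fun u v w h1 h2 h3 => (hX3 (home v) h1 v (memβ u v h2) w (mem_gsph.2 h3)).mono (hle v)
      mid := fun u v w h1 h2 h3 =>
        (hX4 (home v) h1.1 v (memβ u v h2) w (mem_gsph.2 h3)).mono (hle v) }
  have hroute := route_exists hG home x l (fun v => (hh v).2) (fun c => (hc c).2.2.1)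
  choose m t b h1 h2 h3 h4 h5 h6 using hroute
  have rt : ∀ u v, IsRoute G home l u v (m u v) (t u v) (b u v) := fun u v =>
    ⟨h1 u v, h2 u v, h3 u v, h4 u v, h5 u v, h6 u v⟩
  set W : Finset V := {c ∈ C | ¬ ex c} with hW
  set W₂ : Finset V := {c ∈ C | ¬ (σ c : ℝ) ≤ D ^ 2 * r} with hW₂
  set MM : V × V → Finset ℕ := fun p =>
    {q ∈ range (m p.1 p.2) | md (home (b p.1 p.2 q))} with hMM
  have MMlt : ∀ p, ∀ i ∈ MM p, i < m p.1 p.2 ∧ home (b p.1 p.2 i) ∈ W := by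
    intro p i hi
    simp only [hMM, mem_filter, mem_range] at hi
    refine ⟨hi.1, ?_⟩
    simp only [hW, mem_filter]
    exact ⟨(hh _).1, hi.2.2⟩
  set A₀ : (V × V) × Bool → Finset ℕ := fun i =>
    if i.2 then {j ∈ MM i.1 | #{q ∈ MM i.1 | q < j} < r} else
      {j ∈ MM i.1 | #{q ∈ MM i.1 | j < q} < r} with hA₀
  set A : (V × V) × Bool → Finset V := fun i =>
    (A₀ i).image fun j => home (b i.1.1 i.1.2 j) with hA
  have A₀sub : ∀ i, A₀ i ⊆ MM i.1 := by
    intro i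
    simp only [hA₀]
    split_ifs <;> exact filter_subset _ _
  set F : Finset ((V × V) × Bool) := {i | r ≤ #(MM i.1)} with hF
  obtain ⟨S, hS1, hS2⟩ := hit_exists F A W r (by
    intro i hi
    simp only [hF, mem_filter, mem_univ, true_and] at hi
    constructor
    · intro w hw
      simp only [hA, mem_image] at hw
      obtain ⟨j, hj, rfl⟩ := hw
      exact (MMlt _ _ (A₀sub i hj)).2
    · rw [hA, card_image_of_injOn]
      · simp only [hA₀]
        split_ifs
        · exact hit_rank _ _ hi
        · exact hit_rank_nat _ _ hi
      · intro j hj j' hj' e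
        exact (rt _ _).injOn (MMlt _ _ (A₀sub i hj)).1 (MMlt _ _ (A₀sub i hj')).1 e) hr
  have hcomb := base.combine rt S W W₂ ?_ ?_ r hTR ?_ ?_
  · obtain ⟨H, c1, c2, c3⟩ := hcomb
    refine ⟨H, c1, fun u v => (c3 u v).le (by omega), #W, #W₂, by positivity, by positivity,
      ?_, ?_, ?_⟩
    · refine card_mul_le_sum C σ _ N hsum W (filter_subset _ _) fun c hc' => ?_
      simp only [hW, hex, mem_filter, not_le] at hc'
      exact hc'.2.le
    · refine card_mul_le_sum C σ _ N hsum W₂ (filter_subset _ _) fun c hc' => ?_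
      simp only [hW₂, mem_filter, not_le] at hc'
      exact hc'.2.le
    · have hne : 1 ≤ Fintype.card V := by
        have := hG.nonempty
        exact Fintype.card_pos
      have hne' : (1 : ℝ) ≤ Fintype.card V := by exact_mod_cast hne
      have hβsum : ∑ c ∈ C, #(β c) = #Bd :=
        (card_eq_sum_card_fiberwise fun b _ => (hh b).1).symm
      have hBr : (r : ℝ) * #Bd ≤ N := by
        have : #Bd * r ≤ ∑ c ∈ C, σ c := by
          calc #Bd * r ≤ (∑ c ∈ C, #(gsph G c (l c))) * r := by gcongr; exact card_biUnion_le
            _ = ∑ c ∈ C, #(gsph G c (l c)) * r := sum_mul _ _ _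
            _ ≤ _ := sum_le_sum fun c _ => (hc c).2.2.2.2
        have h' : ((#Bd * r : ℕ) : ℝ) ≤ ((∑ c ∈ C, σ c : ℕ) : ℝ) := by exact_mod_cast this
        push_cast at h'
        linarith
      have hH0 : ((C.sup X).edgeSet.ncard : ℝ) ≤ 458 * (D * N) := by
        calc ((C.sup X).edgeSet.ncard : ℝ) ≤ ((∑ c ∈ C, (X c).edgeSet.ncard : ℕ) : ℝ) := by
              exact_mod_cast ncard_fsup_le C X
          _ = ∑ c ∈ C, ((X c).edgeSet.ncard : ℝ) := by push_cast; rfl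
          _ ≤ ∑ c ∈ C, 229 * (D * (σ c + r * #(β c))) := sum_le_sum fun c _ => hX5 c
          _ = 229 * (D * (∑ c ∈ C, (σ c : ℝ) + r * ((∑ c ∈ C, #(β c) : ℕ) : ℝ))) := by
              push_cast
              rw [mul_sum, ← sum_add_distrib, mul_sum, mul_sum]
          _ ≤ 229 * (D * (N + N)) := by
              rw [hβsum]
              gcongr
          _ = _ := by ring
      have hFc : #F ≤ 2 * Fintype.card V ^ 2 := by
        calc #F ≤ Fintype.card ((V × V) × Bool) := card_le_univ _
          _ = _ := by simp only [Fintype.card_prod, Fintype.card_bool]; ring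
      have hlog : Real.log #F ≤ Real.log (2 * (Fintype.card V : ℝ) ^ 2) := by
        rcases Nat.eq_zero_or_pos #F with h0 | h0
        · rw [h0]
          simp only [Nat.cast_zero, Real.log_zero]
          apply Real.log_nonneg
          nlinarith
        · apply Real.log_le_log (by exact_mod_cast h0)
          exact_mod_cast hFc
      have hSc : (#S : ℝ) ≤ #W / r * Real.log (2 * (Fintype.card V : ℝ) ^ 2) + 2 := by
        refine hS1.trans ?_
        gcongr
      have c2' : (H.edgeSet.ncard : ℝ) ≤ 2 * (C.sup X).edgeSet.ncard + 2 * R * (#S * #W) +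
          2 * R * (#W₂ * #W₂) := by exact_mod_cast c2
      have hRr : (R : ℝ) = 3 * (r * 6 ^ k) := by rw [hR]; push_cast; ring
      rw [hRr] at c2'
      have hmul : (#S : ℝ) * #W ≤
          (#W / r * Real.log (2 * (Fintype.card V : ℝ) ^ 2) + 2) * #W := by gcongr
      have hmul2 : 2 * (3 * ((r : ℝ) * 6 ^ k)) * (#S * #W) ≤ 6 * (r * 6 ^ k) *
          ((#W / r * Real.log (2 * (Fintype.card V : ℝ) ^ 2) + 2) * #W) := by
        rw [← mul_assoc 2 3]
        norm_num
        gcongr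
      linarith
  · intro v hv
    simp only [hW, mem_filter]
    exact ⟨(hh v).1, hv⟩
  · intro v hv hv'
    simp only [hW₂, mem_filter]
    exact ⟨(hh v).1, fun h => hv' ⟨h, hv⟩⟩
  · intro u v huv
    obtain ⟨w, hw, hw'⟩ := hS2 ((u, v), true) (by
      simp only [hF, mem_filter, mem_univ, true_and, hMM]; convert huv)
    simp only [hA, mem_image] at hw'
    obtain ⟨j, hj, rfl⟩ := hw'
    refine ⟨j, (MMlt _ _ (A₀sub _ hj)).1, hw, ?_⟩
    simp only [hA₀, if_true, mem_filter] at hj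
    have hj2 := hj.2
    simp only [hMM] at hj2
    convert hj2
  · intro u v huv
    obtain ⟨w, hw, hw'⟩ := hS2 ((u, v), false) (by
      simp only [hF, mem_filter, mem_univ, true_and, hMM]; convert huv)
    simp only [hA, mem_image] at hw'
    obtain ⟨j, hj, rfl⟩ := hw'
    refine ⟨j, (MMlt _ _ (A₀sub _ hj)).1, hw, ?_⟩
    simp only [hA₀, Bool.false_eq_true, if_false, mem_filter] at hj
    have hj2 := hj.2
    simp only [hMM] at hj2
    convert hj2


theorem arith_final (n r ρ D q z N w w₂ L K A E : ℝ) (hr : 1 ≤ r) (hρ : r ≤ ρ) (hD : 1 ≤ D)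
    (hn : 1 ≤ n) (hq : 1 ≤ q) (hqz : q ≤ z) (hN : N = q * n) (h1 : n ≤ D ^ 3 * ρ ^ 2)
    (h2 : n ≤ D ^ 5 * r) (hw : 0 ≤ w) (hw₂ : 0 ≤ w₂) (hwN : w * (D * ρ) ≤ N)
    (hw₂N : w₂ * (D ^ 2 * r) ≤ N) (hL0 : 0 ≤ L) (hL : L ≤ A * z) (hK : 0 ≤ K)
    (hE : E ≤ 916 * (D * N) + 6 * (r * K) * ((w / r * L + 2) * w) + 6 * (r * K) * (w₂ * w₂)) :
    E ≤ (916 + 6 * K * (A + 3)) * (n * D * z ^ 3) := by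
  have hr0 : 0 < r := by linarith
  have hρ0 : 0 < ρ := by linarith
  have hD0 : 0 < D := by linarith
  have hn0 : 0 < n := by linarith
  have hq0 : 0 < q := by linarith
  have hz1 : 1 ≤ z := by linarith
  have hN0 : 0 < N := by rw [hN]; positivity
  have hND : 0 < N * D := by positivity
  have b1 : w ^ 2 ≤ N * q * D := by
    have e : (w * (D * ρ)) ^ 2 ≤ N ^ 2 := by gcongr
    have e2 : N ^ 2 ≤ N * q * (D ^ 3 * ρ ^ 2) := by
      rw [sq]; nth_rewrite 2 [hN]
      rw [← mul_assoc]
      gcongr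
    have e3 : w ^ 2 * (D * ρ) ^ 2 ≤ (N * q * D) * (D * ρ) ^ 2 := by
      calc w ^ 2 * (D * ρ) ^ 2 = (w * (D * ρ)) ^ 2 := by ring
        _ ≤ N * q * (D ^ 3 * ρ ^ 2) := e.trans e2
        _ = _ := by ring
    exact le_of_mul_le_mul_right e3 (by positivity)
  have b2 : r * w ≤ N * D := by
    have e : w * r ≤ w * (D * ρ) := by
      gcongr
      nlinarith
    nlinarith
  have b3 : r * w₂ ^ 2 ≤ N * q * D := by
    have e : (w₂ * (D ^ 2 * r)) ^ 2 ≤ N ^ 2 := by gcongr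
    have e2 : N ^ 2 ≤ N * q * (D ^ 5 * r) := by
      rw [sq]; nth_rewrite 2 [hN]
      rw [← mul_assoc]
      gcongr
    have e3 : (r * w₂ ^ 2) * (D ^ 4 * r) ≤ (N * q * D) * (D ^ 4 * r) := by
      calc (r * w₂ ^ 2) * (D ^ 4 * r) = (w₂ * (D ^ 2 * r)) ^ 2 := by ring
        _ ≤ N * q * (D ^ 5 * r) := e.trans e2
        _ = _ := by ring
    exact le_of_mul_le_mul_right e3 (by positivity)
  have hE2 : E ≤ 916 * (D * N) + 6 * K * (w ^ 2 * L + 2 * (r * w)) + 6 * K * (r * w₂ ^ 2) := by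
    refine hE.trans (le_of_eq ?_)
    field_simp
  have c1 : w ^ 2 * L ≤ N * q * D * (A * z) := by gcongr
  have hND2 : N * D ≤ n * D * z ^ 3 := by
    rw [hN]
    have : q ≤ z ^ 3 := by nlinarith [sq_nonneg z, pow_le_pow_right₀ hz1 (show 1 ≤ 3 by norm_num)]
    nlinarith [mul_pos hn0 hD0]
  have hqq : N * q * D ≤ n * D * z ^ 2 := by
    rw [hN]
    have : q * q ≤ z ^ 2 := by nlinarith
    nlinarith [mul_pos hn0 hD0]
  have hz23 : n * D * z ^ 2 ≤ n * D * z ^ 3 := by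
    gcongr
    norm_num
  have hAz : 0 ≤ A * z := hL0.trans hL
  have c2 : N * q * D * (A * z) ≤ A * (n * D * z ^ 3) := by
    calc N * q * D * (A * z) ≤ n * D * z ^ 2 * (A * z) := by gcongr
      _ = _ := by ring
  set Y := n * D * z ^ 3
  have c3 : w ^ 2 * L + 2 * (r * w) + r * w₂ ^ 2 ≤ (A + 3) * Y := by linarith
  have c4 := mul_le_mul_of_nonneg_left c3 hK
  calc E ≤ 916 * (N * D) + 6 * (K * (w ^ 2 * L + 2 * (r * w) + r * w₂ ^ 2)) := by
        refine hE2.trans (le_of_eq ?_)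
        ring
    _ ≤ 916 * Y + 6 * (K * ((A + 3) * Y)) := by linarith
    _ = _ := by ring

theorem additive_spanner_small_error (d : ℝ) (hd0 : 0 < d) (hd1 : d ≤ 3 / 13)
    (ε : ℝ) (hε : 0 < ε) :
    ∃ C : ℝ, 0 < C ∧
      ∀ (V : Type) [Fintype V] (G : SimpleGraph V), G.Connected →
        ∃ H : SimpleGraph V, H ≤ G ∧
          (∀ u v : V, H.Reachable u v ∧
            (H.dist u v : ℝ) ≤ (G.dist u v : ℝ) + C * (Fintype.card V : ℝ) ^ d) ∧
          (H.edgeSet.ncard : ℝ) ≤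
            C * (Fintype.card V : ℝ) ^ (4 / 3 - 7 * d / 9 + ε) := by
  obtain ⟨k, hk⟩ := exists_nat_gt (4 / ε)
  have hk0 : (0 : ℝ) < k := lt_trans (by positivity) hk
  have hk1 : 1 ≤ k := by exact_mod_cast hk0
  have hkε : 1 / (k : ℝ) ≤ ε / 4 := by
    rw [div_lt_iff₀ hε] at hk
    rw [div_le_div_iff₀ hk0 (by norm_num)]
    linarith
  set K : ℝ := 6 ^ k with hK
  have hK0 : 0 < K := by positivity
  set A : ℝ := 1 + 8 / ε with hA
  have hA0 : 0 < A := by positivity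
  refine ⟨1380 * K + (916 + 6 * K * (A + 3)), by positivity, ?_⟩
  intro V _ G hG
  have hne : 1 ≤ Fintype.card V := by
    have := hG.nonempty
    exact Fintype.card_pos
  set n : ℝ := (Fintype.card V : ℝ) with hn
  have hn1 : 1 ≤ n := by rw [hn]; exact_mod_cast hne
  have hn0 : 0 < n := by linarith
  have hnd : 1 ≤ n ^ d := Real.one_le_rpow hn1 hd0.le
  set r : ℕ := ⌈n ^ d⌉₊ with hr
  have hr1 : n ^ d ≤ r := Nat.le_ceil _
  have hr2 : (r : ℝ) ≤ 2 * n ^ d := by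
    have := Nat.ceil_lt_add_one (show 0 ≤ n ^ d by positivity)
    linarith
  have hr3 : (1 : ℝ) ≤ r := by linarith
  have hr4 : 1 ≤ r := by exact_mod_cast hr3
  set D : ℝ := n ^ (1 / 3 - 7 * d / 9) with hD
  have hD1 : 1 ≤ D := Real.one_le_rpow hn1 (by linarith)
  set q : ℝ := n ^ (1 / (k : ℝ)) with hq
  have hq1 : 1 ≤ q := Real.one_le_rpow hn1 (by positivity)
  set z : ℝ := n ^ (ε / 4) with hz
  have hqz : q ≤ z := Real.rpow_le_rpow_of_exponent_le hn1 hkε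
  have hz1 : 1 ≤ z := by linarith
  obtain ⟨H, hH, hW, w, w₂, hw, hw₂, hwN, hw₂N, hE⟩ := main_fin hG r k hr4 hk1 D hD1 (q * n) rfl
  refine ⟨H, hH, fun u v => ⟨(hW u v).reachable, ?_⟩, ?_⟩
  · have h1 : (H.dist u v : ℝ) ≤ G.dist u v + 690 * (r * K) := by
      have := (hW u v).dist_le
      rw [hK]
      exact_mod_cast this
    have h2 : (r : ℝ) * K ≤ 2 * n ^ d * K := by gcongr
    have h3 : 0 ≤ (916 + 6 * K * (A + 3)) * n ^ d := by positivity
    nlinarith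
  · have hρ : (r : ℝ) ≤ (r : ℝ) ^ (6 / 5 : ℝ) := by
      nth_rewrite 1 [← Real.rpow_one (r : ℝ)]
      exact Real.rpow_le_rpow_of_exponent_le hr3 (by norm_num)
    have h1 : n ≤ D ^ 3 * ((r : ℝ) ^ (6 / 5 : ℝ)) ^ 2 := by
      calc n = n ^ (1 : ℝ) := (Real.rpow_one n).symm
        _ ≤ n ^ ((1 / 3 - 7 * d / 9) * (3 : ℕ) + d * (6 / 5) * (2 : ℕ)) := by
            apply Real.rpow_le_rpow_of_exponent_le hn1
            push_cast
            linarith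
        _ = D ^ 3 * ((n ^ d) ^ (6 / 5 : ℝ)) ^ 2 := by
            rw [Real.rpow_add hn0, Real.rpow_mul_natCast hn0.le, Real.rpow_mul_natCast hn0.le,
              Real.rpow_mul hn0.le d]
        _ ≤ _ := by gcongr
    have h2 : n ≤ D ^ 5 * r := by
      calc n = n ^ (1 : ℝ) := (Real.rpow_one n).symm
        _ ≤ n ^ ((1 / 3 - 7 * d / 9) * (5 : ℕ) + d) := by
            apply Real.rpow_le_rpow_of_exponent_le hn1
            push_cast
            linarith
        _ = D ^ 5 * n ^ d := by
            rw [Real.rpow_add hn0, Real.rpow_mul_natCast hn0.le]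
        _ ≤ _ := by gcongr
    have hL : Real.log (2 * n ^ 2) ≤ A * z := by
      have e1 : Real.log (2 * n ^ 2) = Real.log 2 + 2 * Real.log n := by
        rw [Real.log_mul (by norm_num) (by positivity), Real.log_pow]
        norm_num
      have e2 : Real.log 2 ≤ 1 := by
        have := Real.log_le_sub_one_of_pos (show (0 : ℝ) < 2 by norm_num)
        linarith
      have e3 : Real.log n ≤ z / (ε / 4) := Real.log_le_rpow_div hn0.le (by positivity)
      have e4 : A * z = z + 2 * (z / (ε / 4)) := by rw [hA]; field_simp; ring
      rw [e1, e4]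
      linarith
    have hL0 : 0 ≤ Real.log (2 * n ^ 2) := Real.log_nonneg (by nlinarith)
    have hfin := arith_final n r _ D q z (q * n) w w₂ _ K A _ hr3 hρ hD1 hn1 hq1 hqz rfl h1 h2
      hw hw₂ hwN hw₂N hL0 hL hK0.le hE
    have hexp : n * D * z ^ 3 ≤ n ^ (4 / 3 - 7 * d / 9 + ε) := by
      calc n * D * z ^ 3 = n ^ (1 + (1 / 3 - 7 * d / 9) + ε / 4 * (3 : ℕ)) := by
            rw [Real.rpow_add hn0, Real.rpow_add hn0, Real.rpow_one,
              Real.rpow_mul_natCast hn0.le]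
        _ ≤ _ := by
            apply Real.rpow_le_rpow_of_exponent_le hn1
            push_cast
            linarith
    have hpos : 0 ≤ n ^ (4 / 3 - 7 * d / 9 + ε) := by positivity
    calc (H.edgeSet.ncard : ℝ) ≤ (916 + 6 * K * (A + 3)) * (n * D * z ^ 3) := hfin
      _ ≤ (916 + 6 * K * (A + 3)) * n ^ (4 / 3 - 7 * d / 9 + ε) := by gcongr
      _ ≤ _ := by nlinarith
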